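/- arXiv:2403.07298 — 3 statements merged into one kernel-verified Lean document; each statement's English description precedes it below -/
import Mathlib

section
/- Σ_{n≥0} (-(26-15√3)/16)^n [(30-6√3)n + 7-3√3] ((1/2)_n³/(1)_n³) = 4√2/π. -/
open MeasureTheory Real Filter

/-- Pochhammer symbol `(x)_n`. -/
noncomputable def poch (x : ℝ) (n : ℕ) : ℝ := ∏ i ∈ Finset.range n, (x + i)

/-- Complete elliptic integral of the first kind. -/
noncomputable def K (k : ℝ) : ℝ :=
  ∫ θ in Set.Ioo 0 (Real.pi / 2), 1 / Real.sqrt (1 - k ^ 2 * Real.sin θ ^ 2)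

/-- `K` as a function of the squared modulus, via the hypergeometric series
`K(k) = (π/2) ₂F₁(1/2,1/2;1;k²)`. -/
noncomputable def Ksq (m : ℝ) : ℝ :=
  (Real.pi / 2) * ∑' n : ℕ, poch (1/2) n ^ 2 / poch 1 n ^ 2 * m ^ n

/-- Legendre polynomial `P_n(x)`. -/
noncomputable def P (n : ℕ) (x : ℝ) : ℝ :=
  (1 / 2 ^ n) * ∑ k ∈ Finset.range (n + 1), (n.choose k : ℝ) ^ 2 * (x - 1) ^ (n - k) * (x + 1) ^ k

/-- The coefficient `(h)_n / n!` of the binomial series of `(1 - x) ^ (-h)`. -/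
noncomputable def binomCoeff (h : ℝ) (n : ℕ) : ℝ := poch h n / poch 1 n

/-- The power series with coefficients `c`, acted on `j` times by the Euler operator `x d/dx`. -/
noncomputable def eulerSeries (c : ℕ → ℝ) (j : ℕ) (x : ℝ) : ℝ := ∑' n : ℕ, (n : ℝ) ^ j * c n * x ^ n

lemma poch_pos {h : ℝ} (hh : 0 < h) (n : ℕ) : 0 < poch h n :=
  Finset.prod_pos fun i _ => by positivity

lemma binomCoeff_zero (h : ℝ) : binomCoeff h 0 = 1 := by simp [binomCoeff, poch]

lemma binomCoeff_pos {h : ℝ} (hh : 0 < h) (n : ℕ) : 0 < binomCoeff h n :=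
  div_pos (poch_pos hh n) (poch_pos one_pos n)

lemma binomCoeff_le_one {h : ℝ} (hh : 0 < h) (h1 : h ≤ 1) (n : ℕ) : binomCoeff h n ≤ 1 := by
  rw [binomCoeff, div_le_one (poch_pos one_pos n)]
  exact Finset.prod_le_prod (fun i _ => by positivity) fun i _ => by linarith

lemma binomCoeff_succ (h : ℝ) (n : ℕ) :
    binomCoeff h (n + 1) = (n + h) / (n + 1) * binomCoeff h n := by
  simp only [binomCoeff, poch, Finset.prod_range_succ]
  rw [div_mul_div_comm, mul_comm (n + h), mul_comm ((n : ℝ) + 1), add_comm h, add_comm (1 : ℝ) n]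

lemma abs_binomCoeff_pow_le_one {h : ℝ} (hh : 0 < h) (h1 : h ≤ 1) (p n : ℕ) :
    |binomCoeff h n ^ p| ≤ 1 := by
  rw [abs_of_pos (pow_pos (binomCoeff_pos hh n) p)]
  exact pow_le_one₀ (binomCoeff_pos hh n).le (binomCoeff_le_one hh h1 n)

section EulerSeries

variable {c : ℕ → ℝ} {x : ℝ}

lemma summable_norm_euler (hc : ∀ n, |c n| ≤ 1) (j : ℕ) (hx : |x| < 1) :
    Summable fun n : ℕ => ‖(n : ℝ) ^ j * c n * x ^ n‖ := by
  refine Summable.of_nonneg_of_le (fun _ => norm_nonneg _) (fun n => ?_)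
    (summable_norm_pow_mul_geometric_of_norm_lt_one (r := x) j hx)
  rw [norm_mul, norm_mul, norm_mul, mul_right_comm]
  exact mul_le_of_le_one_right (by positivity) (hc n)

lemma hasSum_euler (hc : ∀ n, |c n| ≤ 1) (j : ℕ) (hx : |x| < 1) :
    HasSum (fun n : ℕ => (n : ℝ) ^ j * c n * x ^ n) (eulerSeries c j x) :=
  (summable_norm_euler hc j hx).of_norm.hasSum

lemma hasDerivAt_euler_tsum (hc : ∀ n, |c n| ≤ 1) (j : ℕ) (hx : |x| < 1) :
    HasDerivAt (eulerSeries c j) (∑' n : ℕ, (n : ℝ) ^ j * c n * (n * x ^ (n - 1))) x := by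
  obtain ⟨r, hxr, hr1⟩ := exists_between hx
  have hr0 : 0 < r := (abs_nonneg x).trans_lt hxr
  have hr : ‖r‖ < 1 := by rwa [Real.norm_of_nonneg hr0.le]
  have hu : Summable fun n : ℕ => r⁻¹ * ((n : ℝ) ^ (j + 1) * r ^ n) :=
    Summable.mul_left _ (summable_pow_mul_geometric_of_norm_lt_one (R := ℝ) (j + 1) hr)
  refine hasDerivAt_tsum_of_isPreconnected (t := Metric.ball 0 r) (y₀ := 0)
    (g := fun (n : ℕ) z => (n : ℝ) ^ j * c n * z ^ n)
    (g' := fun (n : ℕ) z => (n : ℝ) ^ j * c n * (n * z ^ (n - 1))) hu Metric.isOpen_ball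
    (convex_ball _ _).isPreconnected
    (fun n y _ => (hasDerivAt_pow n y).const_mul ((n : ℝ) ^ j * c n)) (fun n y hy => ?_)
    (Metric.mem_ball_self hr0) ?_ (by simpa using hxr)
  · have hy' : |y| ≤ r := by simpa using (Metric.mem_ball.1 hy).le
    rcases n with _ | n
    · simp
    · rw [norm_mul, norm_mul, norm_mul, norm_pow, norm_pow, Real.norm_natCast, Real.norm_eq_abs,
        Real.norm_eq_abs, Nat.add_sub_cancel]
      have h1 : |y| ^ n ≤ r ^ n := pow_le_pow_left₀ (abs_nonneg _) hy' n
      have h2 := hc (n + 1)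
      calc _ ≤ ((n + 1 : ℕ) : ℝ) ^ j * 1 * (((n + 1 : ℕ) : ℝ) * r ^ n) := by gcongr
        _ = _ := by rw [pow_succ r]; field_simp; ring
  · exact (summable_norm_euler hc j (by simp)).of_norm

lemma hasDerivAt_euler (hc : ∀ n, |c n| ≤ 1) (j : ℕ) (hx : |x| < 1) (hx0 : x ≠ 0) :
    HasDerivAt (eulerSeries c j) (eulerSeries c (j + 1) x / x) x := by
  convert! hasDerivAt_euler_tsum hc j hx using 1
  rw [div_eq_iff hx0, eulerSeries, ← tsum_mul_right]
  congr 1 with n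
  rcases n with _ | n
  · simp
  · rw [Nat.add_sub_cancel]; ring

lemma continuousAt_euler (hc : ∀ n, |c n| ≤ 1) (j : ℕ) (hx : |x| < 1) :
    ContinuousAt (eulerSeries c j) x :=
  (hasDerivAt_euler_tsum hc j hx).continuousAt

lemma eulerSeries_zero_zero : eulerSeries c 0 0 = c 0 := by
  rw [eulerSeries, tsum_eq_single 0 fun n hn => by simp [hn]]; simp

lemma eulerSeries_succ_zero (j : ℕ) : eulerSeries c (j + 1) 0 = 0 := by
  rw [eulerSeries, tsum_eq_single 0 fun n hn => by simp [hn]]; simp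

lemma eulerSeries_two_eq (hc : ∀ n, |c n| ≤ 1) (hx : |x| < 1) {h : ℝ}
    (hrec : ∀ n : ℕ, ((n : ℝ) + 1) ^ 2 * c (n + 1) = (n + h) ^ 2 * c n) :
    (1 - x) * eulerSeries c 2 x = x * (2 * h * eulerSeries c 1 x + h ^ 2 * eulerSeries c 0 x) := by
  have h1 := (hasSum_nat_add_iff' 1).2 (hasSum_euler hc 2 hx)
  have h2 := (((hasSum_euler hc 2 hx).add ((hasSum_euler hc 1 hx).mul_left (2 * h))).add
    ((hasSum_euler hc 0 hx).mul_left (h ^ 2))).mul_left x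
  have h3 := h1.unique (h2.congr_fun fun n => ?_)
  · simp at h3
    linear_combination h3
  · have := hrec n
    push_cast
    linear_combination x ^ (n + 1) * this

end EulerSeries

lemma binomCoeff_sq_rec (h : ℝ) (n : ℕ) :
    ((n : ℝ) + 1) ^ 2 * binomCoeff h (n + 1) ^ 2 = (n + h) ^ 2 * binomCoeff h n ^ 2 := by
  rw [binomCoeff_succ]; field_simp

lemma sum_range_binomCoeff_sq (n : ℕ) :
    ∑ k ∈ Finset.range (n + 1), binomCoeff (1 / 4) k ^ 2 * binomCoeff (1 / 4) (n - k) ^ 2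
      = binomCoeff (1 / 2) n ^ 3 := by
  induction n with
  | zero => simp [binomCoeff_zero]
  | succ n ih =>
    set g : ℕ → ℝ := fun k => binomCoeff (1 / 4) k ^ 2 with hg
    have hrec (k : ℕ) : g (k + 1) = (k + 1 / 4) ^ 2 / (k + 1) ^ 2 * g k := by
      simp only [hg, binomCoeff_succ, mul_pow, div_pow]
    set R : ℕ → ℝ := fun k =>
      (2 * k ^ 3 - (7 * n + 4) * k ^ 2 + (n + 1 / 4) * (8 * n + 13 / 2) * k
        - 3 * (n + 1) * (n + 1 / 4) ^ 2) * k ^ 2 * g k * g (n + 1 - k)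
        / (n + 1 / 4 - k) ^ 2 with hR
    have htel : ∑ k ∈ Finset.range (n + 1), (((n : ℝ) + 1) ^ 3 * (g k * g (n + 1 - k))
        - (n + 1 / 2) ^ 3 * (g k * g (n - k))) = R (n + 1) - R 0 := by
      rw [← Finset.sum_range_sub]
      refine Finset.sum_congr rfl fun k hk => ?_
      obtain ⟨j, rfl⟩ := Nat.exists_eq_add_of_le (Nat.lt_succ_iff.1 (Finset.mem_range.1 hk))
      have h1 : k + j + 1 - k = j + 1 := by omega
      have h2 : k + j - k = j := by omega
      have h3 : k + j + 1 - (k + 1) = j := by omega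
      simp only [hR, h1, h2, h3, hrec]
      have h4 : (j : ℝ) * 4 - 3 ≠ 0 := by
        intro h
        have : j * 4 = 3 := by exact_mod_cast sub_eq_zero.1 h
        omega
      have e1 : ((k + j : ℕ) : ℝ) + 1 / 4 - (k + 1 : ℕ) = (j * 4 - 3) / 4 := by push_cast; ring
      have e2 : ((k + j : ℕ) : ℝ) + 1 / 4 - k = j + 1 / 4 := by push_cast; ring
      rw [e1, e2]
      have h5 : (j : ℝ) + 1 / 4 ≠ 0 := by positivity
      have h6 : (j : ℝ) + 1 ≠ 0 := by positivity
      have h7 : (k : ℝ) + 1 ≠ 0 := by positivity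
      push_cast
      field_simp
      ring
    have hR0 : R 0 = 0 := by simp [hR]
    have hg0 : g 0 = 1 := by simp [hg, binomCoeff_zero]
    have hR1 : R (n + 1) = -((n : ℝ) + 1) ^ 3 * g (n + 1) := by
      simp only [hR, Nat.sub_self, hg0]
      push_cast
      rw [div_eq_iff (by ring_nf; norm_num)]
      ring
    rw [Finset.sum_sub_distrib, ← Finset.mul_sum, ← Finset.mul_sum, hR0, hR1, ih] at htel
    rw [Finset.sum_range_succ, Nat.sub_self, binomCoeff_succ (1 / 2)]
    change ∑ k ∈ Finset.range (n + 1), g k * g (n + 1 - k) + g (n + 1) * g 0 = _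
    rw [hg0]
    have hn : ((n : ℝ) + 1) ^ 3 ≠ 0 := by positivity
    refine mul_left_cancel₀ hn ?_
    field_simp
    linear_combination 8 * htel

lemma hasSum_clausen {z : ℝ} (hz : |z| < 1) (A B : ℝ) :
    HasSum (fun n : ℕ => (A * n + B) * binomCoeff (1 / 2) n ^ 3 * z ^ n)
      (eulerSeries (fun n => binomCoeff (1 / 4) n ^ 2) 0 z *
        (2 * A * eulerSeries (fun n => binomCoeff (1 / 4) n ^ 2) 1 z
          + B * eulerSeries (fun n => binomCoeff (1 / 4) n ^ 2) 0 z)) := by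
  set g : ℕ → ℝ := fun n => binomCoeff (1 / 4) n ^ 2 with hg
  have hc : ∀ n, |g n| ≤ 1 := abs_binomCoeff_pow_le_one (by norm_num) (by norm_num) 2
  have s0 := summable_norm_euler hc 0 hz
  have s1 := summable_norm_euler hc 1 hz
  have h00 := (summable_norm_sum_mul_range_of_summable_norm s0 s0).of_norm.hasSum
  have h01 := (summable_norm_sum_mul_range_of_summable_norm s0 s1).of_norm.hasSum
  rw [← tsum_mul_tsum_eq_tsum_sum_range_of_summable_norm s0 s0] at h00
  rw [← tsum_mul_tsum_eq_tsum_sum_range_of_summable_norm s0 s1] at h01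
  convert! (h01.mul_left (2 * A)).add (h00.mul_left B) using 1
  · ext n
    have e0 : ∑ k ∈ Finset.range (n + 1), ((k : ℝ) ^ 0 * g k * z ^ k) *
        (((n - k : ℕ) : ℝ) ^ 0 * g (n - k) * z ^ (n - k)) = binomCoeff (1 / 2) n ^ 3 * z ^ n := by
      rw [← sum_range_binomCoeff_sq, Finset.sum_mul]
      refine Finset.sum_congr rfl fun k hk => ?_
      have : z ^ n = z ^ k * z ^ (n - k) := by
        rw [← pow_add, Nat.add_sub_of_le (Nat.lt_succ_iff.1 (Finset.mem_range.1 hk))]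
      rw [this]; simp only [hg]; ring
    have e1 : 2 * ∑ k ∈ Finset.range (n + 1), ((k : ℝ) ^ 0 * g k * z ^ k) *
        (((n - k : ℕ) : ℝ) ^ 1 * g (n - k) * z ^ (n - k))
        = n * (binomCoeff (1 / 2) n ^ 3 * z ^ n) := by
      rw [two_mul]
      nth_rewrite 1 [← Finset.sum_range_reflect]
      rw [← e0, Finset.mul_sum, ← Finset.sum_add_distrib]
      refine Finset.sum_congr rfl fun k hk => ?_
      have hk' := Nat.lt_succ_iff.1 (Finset.mem_range.1 hk)
      have h1 : n + 1 - 1 - k = n - k := by omega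
      have h2 : n - (n - k) = k := by omega
      rw [h1, h2, Nat.cast_sub hk']
      ring
    rw [e0]
    linear_combination -A * e1
  · simp only [eulerSeries]; ring

lemma eq_of_hasDerivAt_zero {f : ℝ → ℝ} {b : ℝ} (hb : 0 < b)
    (hc : ContinuousOn f (Set.Icc 0 b)) (hd : ∀ y ∈ Set.Ioo 0 b, HasDerivAt f 0 y) :
    f b = f 0 := by
  obtain ⟨_, _, h⟩ := exists_hasDerivAt_eq_slope f (fun _ => 0) hb hc hd
  have := (eq_div_iff (by linarith)).1 h
  linarith

/-- `₂F₁(1/2, 1/2; 1; x)` and its images under powers of the Euler operator. -/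
noncomputable def hyperHalf (j : ℕ) (x : ℝ) : ℝ :=
  eulerSeries (fun n => binomCoeff (1 / 2) n ^ 2) j x

/-- `₂F₁(1/4, 1/4; 1; x)` and its images under powers of the Euler operator. -/
noncomputable def hyperQuarter (j : ℕ) (x : ℝ) : ℝ :=
  eulerSeries (fun n => binomCoeff (1 / 4) n ^ 2) j x

/-- The rational map of the quadratic transformation from `₂F₁(1/4, 1/4; 1)` to
`₂F₁(1/2, 1/2; 1)`. -/
noncomputable def quadMap (x : ℝ) : ℝ := -x ^ 2 / (4 * (1 - x))

section Quadratic

variable {x : ℝ}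

lemma hyperHalf_ode (hx : |x| < 1) :
    (1 - x) * hyperHalf 2 x = x * (hyperHalf 1 x + 1 / 4 * hyperHalf 0 x) := by
  have := eulerSeries_two_eq (abs_binomCoeff_pow_le_one (by norm_num) (by norm_num) 2) hx
    (binomCoeff_sq_rec (1 / 2))
  rw [hyperHalf, this, hyperHalf, hyperHalf]; ring

lemma hyperQuarter_ode (hx : |x| < 1) :
    (1 - x) * hyperQuarter 2 x = x * (1 / 2 * hyperQuarter 1 x + 1 / 16 * hyperQuarter 0 x) := by
  have := eulerSeries_two_eq (abs_binomCoeff_pow_le_one (by norm_num) (by norm_num) 2) hx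
    (binomCoeff_sq_rec (1 / 4))
  rw [hyperQuarter, this, hyperQuarter, hyperQuarter]; ring

lemma hasDerivAt_hyperHalf (j : ℕ) (hx : |x| < 1) (hx0 : x ≠ 0) :
    HasDerivAt (hyperHalf j) (hyperHalf (j + 1) x / x) x :=
  hasDerivAt_euler (abs_binomCoeff_pow_le_one (by norm_num) (by norm_num) 2) j hx hx0

lemma hasDerivAt_hyperQuarter (j : ℕ) (hx : |x| < 1) (hx0 : x ≠ 0) :
    HasDerivAt (hyperQuarter j) (hyperQuarter (j + 1) x / x) x :=
  hasDerivAt_euler (abs_binomCoeff_pow_le_one (by norm_num) (by norm_num) 2) j hx hx0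

lemma continuousAt_hyperHalf (j : ℕ) (hx : |x| < 1) : ContinuousAt (hyperHalf j) x :=
  continuousAt_euler (abs_binomCoeff_pow_le_one (by norm_num) (by norm_num) 2) j hx

lemma continuousAt_hyperQuarter (j : ℕ) (hx : |x| < 1) : ContinuousAt (hyperQuarter j) x :=
  continuousAt_euler (abs_binomCoeff_pow_le_one (by norm_num) (by norm_num) 2) j hx

lemma hyperHalf_zero_pos (hx0 : 0 ≤ x) (hx : |x| < 1) : 0 < hyperHalf 0 x := by
  have h := hasSum_euler (abs_binomCoeff_pow_le_one (h := 1 / 2) (by norm_num) (by norm_num) 2) 0 hx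
  have h1 := le_hasSum h 0 fun n _ => by positivity
  rw [binomCoeff_zero] at h1
  norm_num at h1
  exact one_pos.trans_le h1

lemma abs_quadMap_lt_one (hx0 : 0 ≤ x) (hx : x < 1 / 2) : |quadMap x| < 1 := by
  rw [quadMap, neg_div, abs_neg, abs_of_nonneg (div_nonneg (sq_nonneg x) (by linarith)),
    div_lt_one (by linarith)]
  nlinarith

lemma hasDerivAt_quadMap (hx0 : x ≠ 0) (hx : x < 1) :
    HasDerivAt quadMap (quadMap x * ((2 - x) / ((1 - x) * x))) x := by
  have h1 : 1 - x ≠ 0 := by linarith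
  have h : HasDerivAt (fun y : ℝ => 4 * (1 - y)) (4 * (0 - 1)) x :=
    ((hasDerivAt_const x 1).sub (hasDerivAt_id x)).const_mul 4
  convert! ((hasDerivAt_pow 2 x).neg).div h (by simpa using h1) using 1
  simp only [quadMap, Pi.neg_apply]
  push_cast
  field_simp
  ring

lemma hasDerivAt_hyperQuarter_quadMap (j : ℕ) (hx0 : 0 < x) (hx : x < 1 / 2) :
    HasDerivAt (fun y => hyperQuarter j (quadMap y))
      (hyperQuarter (j + 1) (quadMap x) * ((2 - x) / ((1 - x) * x))) x := by
  have hz : quadMap x ≠ 0 := by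
    rw [quadMap]
    exact div_ne_zero (neg_ne_zero.2 (by positivity)) (by linarith)
  convert! (hasDerivAt_hyperQuarter j (abs_quadMap_lt_one hx0.le hx) hz).comp x
    (hasDerivAt_quadMap hx0.ne' (by linarith)) using 1
  field_simp

lemma hasDerivAt_one_sub_rpow (s : ℝ) (hx : x < 1) :
    HasDerivAt (fun y : ℝ => (1 - y) ^ s) (-s * (1 - x) ^ s / (1 - x)) x := by
  have h1 : 0 < 1 - x := by linarith
  have h : HasDerivAt (fun y : ℝ => 1 - y) (-1) x := by
    simpa using (hasDerivAt_id x).const_sub 1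
  convert! h.rpow_const (p := s) (Or.inl h1.ne') using 1
  rw [Real.rpow_sub_one h1.ne']
  ring

lemma continuousAt_hyperQuarter_quadMap (j : ℕ) (hx0 : 0 ≤ x) (hx : x < 1 / 2) :
    ContinuousAt (fun y => hyperQuarter j (quadMap y)) x := by
  refine ContinuousAt.comp (continuousAt_hyperQuarter j (abs_quadMap_lt_one hx0 hx)) ?_
  unfold quadMap
  have : 4 * (1 - x) ≠ 0 := by linarith
  fun_prop (disch := assumption)

lemma quadratic_wronskian_eq_zero (hx0 : 0 < x) (hx : x < 1 / 2) :
    (2 - x) / (1 - x) * hyperQuarter 1 (quadMap x) * hyperHalf 0 x =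
      hyperQuarter 0 (quadMap x) * (hyperHalf 1 x - x / (4 * (1 - x)) * hyperHalf 0 x) := by
  set W : ℝ → ℝ := fun y => (1 - y) ^ (3 / 4 : ℝ) *
    ((1 + (1 - y)⁻¹) * hyperQuarter 1 (quadMap y) * hyperHalf 0 y -
      hyperQuarter 0 (quadMap y) * (hyperHalf 1 y - (1 / 4) * ((1 - y)⁻¹ - 1) * hyperHalf 0 y))
    with hW
  have hcont : ContinuousOn W (Set.Icc 0 x) := by
    intro y ⟨hy0, hy1⟩
    have hy : |y| < 1 := by rw [abs_lt]; constructor <;> linarith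
    have c0 := continuousAt_hyperHalf 0 hy
    have c1 := continuousAt_hyperHalf 1 hy
    have d0 := continuousAt_hyperQuarter_quadMap 0 hy0 (hy1.trans_lt hx)
    have d1 := continuousAt_hyperQuarter_quadMap 1 hy0 (hy1.trans_lt hx)
    have e := (hasDerivAt_one_sub_rpow (3 / 4) (abs_lt.1 hy).2).continuousAt
    have hne : 1 - y ≠ 0 := by linarith
    have f : ContinuousAt (fun y : ℝ => (1 - y)⁻¹) y := by fun_prop (disch := assumption)
    have hW' : ContinuousAt W y := e.mul ((((continuousAt_const.add f).mul d1).mul c0).sub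
      (d0.mul (c1.sub ((continuousAt_const.mul (f.sub continuousAt_const)).mul c0))))
    exact hW'.continuousWithinAt
  have hder : ∀ y ∈ Set.Ioo 0 x, HasDerivAt W 0 y := by
    intro y ⟨hy0, hy1⟩
    have hy2 := hy1.trans hx
    have hy : |y| < 1 := by rw [abs_lt]; constructor <;> linarith
    have c0 := hasDerivAt_hyperHalf 0 hy hy0.ne'
    have c1 := hasDerivAt_hyperHalf 1 hy hy0.ne'
    have d0 := hasDerivAt_hyperQuarter_quadMap 0 hy0 hy2
    have d1 := hasDerivAt_hyperQuarter_quadMap 1 hy0 hy2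
    have e := hasDerivAt_one_sub_rpow (3 / 4) (abs_lt.1 hy).2
    have hne : 1 - y ≠ 0 := by linarith
    have hne2 : 2 - y ≠ 0 := by linarith
    have f : HasDerivAt (fun y : ℝ => (1 - y)⁻¹) (1 / (1 - y) ^ 2) y := by
      convert! ((hasDerivAt_id y).const_sub 1).inv hne using 1
      simp
    have o1 := hyperHalf_ode hy
    have o2 := hyperQuarter_ode (abs_quadMap_lt_one hy0.le hy2)
    have o1' : hyperHalf 2 y = y * (hyperHalf 1 y + 1 / 4 * hyperHalf 0 y) / (1 - y) := by
      rw [eq_div_iff hne, mul_comm]; exact o1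
    have o2' : hyperQuarter 2 (quadMap y) = -y ^ 2 * (1 / 2 * hyperQuarter 1 (quadMap y)
        + 1 / 16 * hyperQuarter 0 (quadMap y)) / (2 - y) ^ 2 := by
      rw [eq_div_iff (pow_ne_zero 2 hne2)]
      have h1 : 1 - quadMap y = (2 - y) ^ 2 / (4 * (1 - y)) := by
        rw [quadMap]; field_simp; ring
      rw [h1] at o2
      have h2 : quadMap y = -y ^ 2 / (4 * (1 - y)) := rfl
      generalize hyperQuarter 2 (quadMap y) = a at *
      generalize hyperQuarter 1 (quadMap y) = b at *
      generalize hyperQuarter 0 (quadMap y) = c at *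
      rw [h2] at o2
      field_simp at o2 ⊢
      linear_combination o2
    convert! e.mul ((((f.const_add 1).mul d1).mul c0).sub
      (d0.mul (c1.sub (((f.sub_const 1).const_mul (1 / 4)).mul c0)))) using 1
    simp only [Pi.mul_apply, Pi.sub_apply, o1', o2', Nat.reduceAdd, zero_add]
    field_simp
    ring
  have h0 := eq_of_hasDerivAt_zero hx0 hcont hder
  have hq : quadMap 0 = 0 := by simp [quadMap]
  have hW0 : W 0 = 0 := by
    simp [hW, hq, hyperQuarter, hyperHalf, eulerSeries_succ_zero]
  have h1 : 0 < 1 - x := by linarith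
  rw [hW0] at h0
  have h2 := (mul_eq_zero.1 h0).resolve_left (Real.rpow_pos_of_pos h1 _).ne'
  have h3 : (2 - x) / (1 - x) = 1 + (1 - x)⁻¹ := by field_simp; ring
  have h4 : x / (4 * (1 - x)) = 1 / 4 * ((1 - x)⁻¹ - 1) := by field_simp; ring
  rw [h3, h4]
  linarith

lemma hyperQuarter_quadMap (hx0 : 0 < x) (hx : x < 1 / 2) :
    hyperQuarter 0 (quadMap x) = (1 - x) ^ (1 / 4 : ℝ) * hyperHalf 0 x := by
  set Q : ℝ → ℝ := fun y => (1 - y) ^ (-(1 / 4) : ℝ) * hyperQuarter 0 (quadMap y) / hyperHalf 0 y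
    with hQ
  have hcont : ContinuousOn Q (Set.Icc 0 x) := by
    intro y ⟨hy0, hy1⟩
    have hy : |y| < 1 := by rw [abs_lt]; constructor <;> linarith
    have c0 := continuousAt_hyperHalf 0 hy
    have d0 := continuousAt_hyperQuarter_quadMap 0 hy0 (hy1.trans_lt hx)
    have e := (hasDerivAt_one_sub_rpow (-(1 / 4)) (abs_lt.1 hy).2).continuousAt
    exact ((e.mul d0).div c0 (hyperHalf_zero_pos hy0 hy).ne').continuousWithinAt
  have hder : ∀ y ∈ Set.Ioo 0 x, HasDerivAt Q 0 y := by
    intro y ⟨hy0, hy1⟩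
    have hy2 := hy1.trans hx
    have hy : |y| < 1 := by rw [abs_lt]; constructor <;> linarith
    have hpos := hyperHalf_zero_pos hy0.le hy
    have hne : 1 - y ≠ 0 := by linarith
    have hw := quadratic_wronskian_eq_zero hy0 hy2
    convert! ((hasDerivAt_one_sub_rpow (-(1 / 4)) (abs_lt.1 hy).2).mul
      (hasDerivAt_hyperQuarter_quadMap 0 hy0 hy2)).div
      (hasDerivAt_hyperHalf 0 hy hy0.ne') hpos.ne' using 1
    simp only [Pi.mul_apply, zero_add]
    rw [eq_comm, div_eq_zero_iff]
    left
    field_simp at hw ⊢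
    linear_combination (1 - y) ^ (-(1 / 4) : ℝ) * hw
  have h0 := eq_of_hasDerivAt_zero hx0 hcont hder
  have hq : quadMap 0 = 0 := by simp [quadMap]
  have hQ0 : Q 0 = 1 := by
    simp [hQ, hq, hyperQuarter, hyperHalf, eulerSeries_zero_zero, binomCoeff_zero]
  rw [hQ0] at h0
  have hpos := hyperHalf_zero_pos hx0.le (by rw [abs_lt]; constructor <;> linarith)
  have h1 : 0 < 1 - x := by linarith
  rw [hQ, div_eq_one_iff_eq hpos.ne', Real.rpow_neg h1.le] at h0
  rw [← h0, ← mul_assoc, mul_inv_cancel₀ (Real.rpow_pos_of_pos h1 _).ne', one_mul]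

lemma hyperQuarter_one_quadMap (hx0 : 0 < x) (hx : x < 1 / 2) :
    (2 - x) / (1 - x) * hyperQuarter 1 (quadMap x) =
      (1 - x) ^ (1 / 4 : ℝ) * (hyperHalf 1 x - x / (4 * (1 - x)) * hyperHalf 0 x) := by
  have hpos := hyperHalf_zero_pos hx0.le (by rw [abs_lt]; constructor <;> linarith)
  refine mul_right_cancel₀ hpos.ne' ?_
  rw [quadratic_wronskian_eq_zero hx0 hx, hyperQuarter_quadMap hx0 hx]
  ring

end Quadratic

section EllipticIntegrals

variable {x : ℝ}

lemma euler_binomCoeff_one_eq {h : ℝ} (hh : 0 < h) (h1 : h ≤ 1) (hx : |x| < 1) :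
    (1 - x) * eulerSeries (binomCoeff h) 1 x = x * (h * eulerSeries (binomCoeff h) 0 x) := by
  have hc : ∀ n, |binomCoeff h n| ≤ 1 := by simpa using abs_binomCoeff_pow_le_one hh h1 1
  have e1 := (hasSum_nat_add_iff' 1).2 (hasSum_euler hc 1 hx)
  have e2 := ((hasSum_euler hc 1 hx).add ((hasSum_euler hc 0 hx).mul_left h)).mul_left x
  have e3 := e1.unique (e2.congr_fun fun n => ?_)
  · simp at e3
    linear_combination e3
  · rw [binomCoeff_succ]
    push_cast
    field_simp
    ring

lemma euler_binomCoeff_half_zero (hx0 : 0 ≤ x) (hx : x < 1) :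
    eulerSeries (binomCoeff (1 / 2)) 0 x = 1 / √(1 - x) := by
  have hc : ∀ n, |binomCoeff (1 / 2) n| ≤ 1 := by
    simpa using abs_binomCoeff_pow_le_one (h := 1 / 2) (by norm_num) (by norm_num) 1
  rcases hx0.eq_or_lt with rfl | hx0
  · simp [eulerSeries_zero_zero, binomCoeff_zero]
  have hpos : 0 < 1 - x := by linarith
  have h0 := eq_of_hasDerivAt_zero
    (f := fun y => (1 - y) ^ (1 / 2 : ℝ) * eulerSeries (binomCoeff (1 / 2)) 0 y) hx0 ?_ ?_
  · simp only [sub_zero, eulerSeries_zero_zero, binomCoeff_zero,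
      ← Real.sqrt_eq_rpow, Real.sqrt_one, mul_one] at h0
    rw [eq_div_iff (Real.sqrt_pos.2 hpos).ne', mul_comm]
    exact h0
  · intro y ⟨hy0, hy1⟩
    have hy : |y| < 1 := by rw [abs_lt]; constructor <;> linarith
    exact ((hasDerivAt_one_sub_rpow (1 / 2) (abs_lt.1 hy).2).continuousAt.mul
      (continuousAt_euler hc 0 hy)).continuousWithinAt
  · intro y ⟨hy0, hy1⟩
    have hy : |y| < 1 := by rw [abs_lt]; constructor <;> linarith
    have hne : 1 - y ≠ 0 := by linarith
    have o := euler_binomCoeff_one_eq (h := 1 / 2) (by norm_num) (by norm_num) hy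
    convert! (hasDerivAt_one_sub_rpow (1 / 2) (abs_lt.1 hy).2).mul
      (hasDerivAt_euler hc 0 hy hy0.ne') using 1
    simp only [zero_add]
    field_simp
    linear_combination -(1 - y) ^ (1 / 2 : ℝ) * 2 * o

lemma euler_binomCoeff_half_one (hx0 : 0 ≤ x) (hx : x < 1) :
    eulerSeries (binomCoeff (1 / 2)) 1 x = x / (2 * √(1 - x) ^ 3) := by
  have hpos : 0 < 1 - x := by linarith
  have hs := Real.sqrt_pos.2 hpos
  have o := euler_binomCoeff_one_eq (h := 1 / 2) (by norm_num) (by norm_num)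
    (by rw [abs_lt]; constructor <;> linarith : |x| < 1)
  rw [euler_binomCoeff_half_zero hx0 hx] at o
  refine mul_left_cancel₀ hpos.ne' (o.trans ?_)
  nth_rewrite 2 [← Real.sq_sqrt hpos.le]
  field_simp

lemma integral_sin_pow_eq_binomCoeff (n : ℕ) :
    ∫ θ in 0..π, Real.sin θ ^ (2 * n) = π * binomCoeff (1 / 2) n := by
  rw [integral_sin_pow_even, binomCoeff, poch, poch, ← Finset.prod_div_distrib]
  congr 1
  refine Finset.prod_congr rfl fun i _ => ?_
  field_simp
  ring

lemma pi_mul_hyperHalf (j : ℕ) (hx : |x| < 1) :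
    π * hyperHalf j x =
      ∫ θ in 0..π, eulerSeries (binomCoeff (1 / 2)) j (x * Real.sin θ ^ 2) := by
  have hc : ∀ n, |binomCoeff (1 / 2) n| ≤ 1 := by
    simpa using abs_binomCoeff_pow_le_one (h := 1 / 2) (by norm_num) (by norm_num) 1
  have hs (θ : ℝ) : |x * Real.sin θ ^ 2| ≤ |x| := by
    rw [abs_mul, abs_of_nonneg (sq_nonneg (Real.sin θ))]
    exact mul_le_of_le_one_right (abs_nonneg x) (Real.sin_sq_le_one θ)
  have key := intervalIntegral.hasSum_integral_of_dominated_convergence (μ := volume)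
    (a := 0) (b := π)
    (F := fun (n : ℕ) θ => (n : ℝ) ^ j * binomCoeff (1 / 2) n * (x * Real.sin θ ^ 2) ^ n)
    (f := fun θ => eulerSeries (binomCoeff (1 / 2)) j (x * Real.sin θ ^ 2))
    (fun n _ => ‖(n : ℝ) ^ j * binomCoeff (1 / 2) n * x ^ n‖)
    (fun n => (by fun_prop : Continuous _).aestronglyMeasurable)
    (fun n => ae_of_all _ fun θ _ => ?_)
    (ae_of_all _ fun θ _ => summable_norm_euler hc j hx)
    intervalIntegrable_const
    (ae_of_all _ fun θ _ => hasSum_euler hc j ((hs θ).trans_lt hx))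
  · refine HasSum.unique ?_ key
    have h := (hasSum_euler (abs_binomCoeff_pow_le_one (h := 1 / 2)
      (by norm_num) (by norm_num) 2) j hx).mul_left π
    refine h.congr_fun fun n => ?_
    simp only [mul_pow, ← pow_mul, ← mul_assoc]
    rw [intervalIntegral.integral_const_mul, integral_sin_pow_eq_binomCoeff]
    ring
  · rw [norm_mul, norm_mul, norm_mul, norm_mul, norm_pow (x * _), norm_pow x,
      Real.norm_eq_abs (x * _), Real.norm_eq_abs x]
    exact mul_le_mul_of_nonneg_left (pow_le_pow_left₀ (abs_nonneg _) (hs θ) n) (by positivity)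

end EllipticIntegrals

section EquianharmonicSubstitution

lemma beta_eq_integral {a b : ℝ} (ha : 0 < a) (hb : 0 < b) :
    ProbabilityTheory.beta a b = ∫ x in Set.Ioo (0 : ℝ) 1, x ^ (a - 1) * (1 - x) ^ (b - 1) := by
  rw [ProbabilityTheory.beta_eq_betaIntegralReal a b ha hb, Complex.betaIntegral,
    intervalIntegral.integral_of_le zero_le_one, ← integral_Ioc_eq_integral_Ioo,
    ← RCLike.re_to_complex, ← integral_re]
  · refine setIntegral_congr_fun measurableSet_Ioc fun x ⟨hx1, hx2⟩ => ?_
    norm_cast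
    rw [← Complex.ofReal_cpow, ← Complex.ofReal_cpow, RCLike.re_to_complex,
      Complex.re_mul_ofReal, Complex.ofReal_re]
    all_goals linarith
  · have h := Complex.betaIntegral_convergent (u := a) (v := b) (by simpa) (by simpa)
    rwa [intervalIntegrable_iff_integrableOn_Ioc_of_le zero_le_one] at h

/-- `Δ(θ) = √(1 - k² sin² θ)` for the modulus `k = sin (π / 12)`. -/
noncomputable def delta (θ : ℝ) : ℝ := √(1 - (2 - √3) / 4 * Real.sin θ ^ 2)

/-- The denominator of `cubeRootSub`. -/
noncomputable def subDenom (θ : ℝ) : ℝ := (√3 + 1) - (√3 - 1) * Real.cos θ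

/-- Legendre's substitution, taking `dt / √(t (1 - t ^ 3))` on `(0, 1)` to a multiple of
`dθ / Δ(θ)` on `(0, π)`. -/
noncomputable def cubeRootSub (θ : ℝ) : ℝ := (1 + Real.cos θ) / subDenom θ

lemma sqrt_three_sq : √3 ^ 2 = (3 : ℝ) := Real.sq_sqrt (by norm_num)

lemma one_lt_sqrt_three : 1 < √(3 : ℝ) := by
  rw [Real.lt_sqrt] <;> norm_num

lemma sqrt_three_lt_two : √(3 : ℝ) < 2 := by
  rw [Real.sqrt_lt'] <;> norm_num

lemma delta_radicand_pos (θ : ℝ) : 0 < 1 - (2 - √3) / 4 * Real.sin θ ^ 2 := by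
  have := Real.sin_sq_le_one θ
  nlinarith [one_lt_sqrt_three, sqrt_three_lt_two]

lemma delta_pos (θ : ℝ) : 0 < delta θ := Real.sqrt_pos.2 (delta_radicand_pos θ)

lemma delta_sq (θ : ℝ) : delta θ ^ 2 = 1 - (2 - √3) / 4 * Real.sin θ ^ 2 :=
  Real.sq_sqrt (delta_radicand_pos θ).le

lemma subDenom_pos (θ : ℝ) : 0 < subDenom θ := by
  rw [subDenom]
  nlinarith [Real.cos_le_one θ, one_lt_sqrt_three]

lemma continuous_delta : Continuous delta := by unfold delta; fun_prop

lemma continuous_subDenom : Continuous subDenom := by unfold subDenom; fun_prop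

lemma continuous_cubeRootSub : Continuous cubeRootSub :=
  (by fun_prop : Continuous fun θ => 1 + Real.cos θ).div continuous_subDenom
    fun θ => (subDenom_pos θ).ne'

lemma hasDerivAt_subDenom (θ : ℝ) : HasDerivAt subDenom ((√3 - 1) * Real.sin θ) θ := by
  convert! ((Real.hasDerivAt_cos θ).const_mul (√3 - 1)).const_sub (√3 + 1) using 1
  ring

lemma hasDerivAt_delta (θ : ℝ) :
    HasDerivAt delta (-((2 - √3) / 4 * Real.sin θ * Real.cos θ) / delta θ) θ := by
  have h := ((((Real.hasDerivAt_sin θ).pow 2).const_mul ((2 - √3) / 4)).const_sub 1).sqrt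
    (delta_radicand_pos θ).ne'
  convert! h using 1
  simp only [Pi.pow_apply]
  rw [delta]
  push_cast
  field_simp

lemma hasDerivAt_cubeRootSub (θ : ℝ) :
    HasDerivAt cubeRootSub (-(2 * √3 * Real.sin θ / subDenom θ ^ 2)) θ := by
  have h := ((Real.hasDerivAt_cos θ).const_add 1).div (hasDerivAt_subDenom θ) (subDenom_pos θ).ne'
  convert! h using 1
  rw [← neg_div]
  congr 1
  rw [subDenom]
  ring

lemma cubeRootSub_strictAntiOn : StrictAntiOn cubeRootSub (Set.Icc 0 π) := by
  refine strictAntiOn_of_deriv_neg (convex_Icc 0 π) continuous_cubeRootSub.continuousOn ?_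
  intro θ hθ
  rw [interior_Icc] at hθ
  rw [(hasDerivAt_cubeRootSub θ).deriv, neg_lt_zero]
  have := Real.sin_pos_of_mem_Ioo hθ
  have := subDenom_pos θ
  positivity

lemma cubeRootSub_zero : cubeRootSub 0 = 1 := by
  rw [cubeRootSub, div_eq_one_iff_eq (subDenom_pos 0).ne', subDenom, Real.cos_zero]; ring

lemma cubeRootSub_pi : cubeRootSub π = 0 := by simp [cubeRootSub]

lemma cubeRootSub_mem {θ : ℝ} (hθ : θ ∈ Set.Ioo 0 π) : cubeRootSub θ ∈ Set.Ioo 0 1 := by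
  have h := Set.Ioo_subset_Icc_self hθ
  constructor
  · rw [← cubeRootSub_pi]
    exact cubeRootSub_strictAntiOn h (Set.right_mem_Icc.2 pi_pos.le) hθ.2
  · rw [← cubeRootSub_zero]
    exact cubeRootSub_strictAntiOn (Set.left_mem_Icc.2 pi_pos.le) h hθ.1

lemma cubeRootSub_cube_strictAntiOn : StrictAntiOn (fun θ => cubeRootSub θ ^ 3) (Set.Icc 0 π) :=
  fun a ha b hb hab => pow_lt_pow_left₀ (cubeRootSub_strictAntiOn ha hb hab)
    (by
      rw [← cubeRootSub_pi]
      exact cubeRootSub_strictAntiOn.antitoneOn hb (Set.right_mem_Icc.2 pi_pos.le) hb.2)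
    (by norm_num)

lemma image_cubeRootSub_cube : (fun θ => cubeRootSub θ ^ 3) '' Set.Ioo 0 π = Set.Ioo 0 1 := by
  refine Set.Subset.antisymm ?_ ?_
  · rintro _ ⟨θ, hθ, rfl⟩
    obtain ⟨h0, h1⟩ := cubeRootSub_mem hθ
    exact ⟨pow_pos h0 3, pow_lt_one₀ h0.le h1 (by norm_num)⟩
  · have h := intermediate_value_Ioo' pi_pos.le (f := fun θ => cubeRootSub θ ^ 3)
      (continuous_cubeRootSub.pow 3).continuousOn
    simpa [cubeRootSub_zero, cubeRootSub_pi] using h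

lemma sqrt_cubeRootSub {θ : ℝ} (hθ : θ ∈ Set.Ioo 0 π) :
    √(cubeRootSub θ * (1 - cubeRootSub θ ^ 3)) =
      √(√3) * (2 * √3 * Real.sin θ / subDenom θ ^ 2) * delta θ := by
  have hs := Real.sin_pos_of_mem_Ioo hθ
  have hd := subDenom_pos θ
  have hw := delta_pos θ
  rw [Real.sqrt_eq_iff_mul_self_eq_of_pos (by positivity), ← sq, mul_pow, mul_pow,
    Real.sq_sqrt (Real.sqrt_nonneg 3), delta_sq, cubeRootSub]
  field_simp
  have h3 := sqrt_three_sq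
  have hsc := Real.sin_sq_add_cos_sq θ
  rw [subDenom]
  generalize √3 = r at *
  generalize Real.sin θ = s at *
  generalize Real.cos θ = c at *
  grind

lemma beta_half_eq_integral {a : ℝ} (ha : 0 < a) :
    ProbabilityTheory.beta a (1 / 2) =
      3 / √(√3) * ∫ θ in 0..π, cubeRootSub θ ^ (3 * a - 1 / 2) / delta θ := by
  rw [beta_eq_integral ha (by norm_num), ← image_cubeRootSub_cube,
    integral_image_eq_integral_abs_deriv_smul (f := fun θ => cubeRootSub θ ^ 3) measurableSet_Ioo
      (fun θ _ => ((hasDerivAt_cubeRootSub θ).pow 3).hasDerivWithinAt)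
      (cubeRootSub_cube_strictAntiOn.injOn.mono Set.Ioo_subset_Icc_self),
    intervalIntegral.integral_of_le pi_pos.le, integral_Ioc_eq_integral_Ioo, ← integral_const_mul]
  refine setIntegral_congr_fun measurableSet_Ioo fun θ hθ => ?_
  have hs := Real.sin_pos_of_mem_Ioo hθ
  have hd := subDenom_pos θ
  have hw := delta_pos θ
  obtain ⟨h0, h1⟩ := cubeRootSub_mem hθ
  have hq := sqrt_cubeRootSub hθ
  set t := cubeRootSub θ with ht
  have h2 : 0 < 1 - t ^ 3 := sub_pos.2 (pow_lt_one₀ h0.le h1 (by norm_num))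
  rw [Real.sqrt_mul h0.le] at hq
  set D := 2 * √3 * Real.sin θ / subDenom θ ^ 2 with hD
  have hDpos : 0 < D := by positivity
  have e1 : |((3 : ℕ) : ℝ) * t ^ (3 - 1) * -D| = 3 * t ^ 2 * D := by
    rw [mul_neg, abs_neg, abs_of_pos (by positivity)]; norm_num
  have e2 : (1 - t ^ 3) ^ ((1 : ℝ) / 2 - 1) = (√(1 - t ^ 3))⁻¹ := by
    rw [Real.sqrt_eq_rpow, ← Real.rpow_neg h2.le]; norm_num
  have e3 : t ^ 2 * (t ^ 3) ^ (a - 1) * √t = t ^ (3 * a - 1 / 2) := by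
    rw [Real.sqrt_eq_rpow, ← Real.rpow_natCast t 2, ← Real.rpow_natCast t 3, ← Real.rpow_mul h0.le,
      ← Real.rpow_add h0, ← Real.rpow_add h0]
    congr 1
    push_cast
    ring
  change |((3 : ℕ) : ℝ) * t ^ (3 - 1) * -D| • ((t ^ 3) ^ (a - 1) * (1 - t ^ 3) ^ ((1 : ℝ) / 2 - 1))
    = 3 / √(√3) * (t ^ (3 * a - 1 / 2) / delta θ)
  rw [e1, e2, ← e3, smul_eq_mul]
  have h4 : 0 < √(1 - t ^ 3) := Real.sqrt_pos.2 h2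
  have h5 : 0 < √(√(3 : ℝ)) := by positivity
  field_simp
  linear_combination -hq

lemma beta_sixth_mul_beta_five_sixths :
    ProbabilityTheory.beta (1 / 6) (1 / 2) * ProbabilityTheory.beta (5 / 6) (1 / 2)
      = 3 * √3 * π := by
  have g1 := Real.Gamma_mul_Gamma_one_sub (1 / 6)
  have g2 := Real.Gamma_mul_Gamma_one_sub (1 / 3)
  have g3 := Real.Gamma_add_one (s := 1 / 3) (by norm_num)
  rw [show π * (1 / 6) = π / 6 by ring, Real.sin_pi_div_six] at g1
  rw [show π * (1 / 3) = π / 3 by ring, Real.sin_pi_div_three] at g2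
  norm_num at g1 g2 g3
  simp only [ProbabilityTheory.beta, Real.Gamma_one_half_eq]
  norm_num
  rw [g3]
  have p1 : 0 < Real.Gamma (1 / 3) := Real.Gamma_pos_of_pos (by norm_num)
  have p2 : 0 < Real.Gamma (2 / 3) := Real.Gamma_pos_of_pos (by norm_num)
  have hpi : √π ^ 2 = π := Real.sq_sqrt pi_pos.le
  have h3 := sqrt_three_sq
  field_simp at g2 ⊢
  rw [hpi]
  linear_combination π * g1 - π * g2

/-- A primitive comparing the elliptic integrals obtained from the two beta integrals. -/
noncomputable def legendrePrimitive (θ : ℝ) : ℝ :=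
  -(Real.sin θ * ((3 + √3) + (3 - √3) * Real.cos θ)) / (delta θ * subDenom θ)

lemma hasDerivAt_legendrePrimitive (θ : ℝ) :
    HasDerivAt legendrePrimitive
      (1 / delta θ + √3 / 4 * Real.sin θ ^ 2 / delta θ ^ 3
        - 4 * (cubeRootSub θ ^ 2 / delta θ)) θ := by
  have hd := subDenom_pos θ
  have hw := delta_pos θ
  have h := (((Real.hasDerivAt_sin θ).mul
    (((Real.hasDerivAt_cos θ).const_mul (3 - √3)).const_add (3 + √3))).neg).div
    ((hasDerivAt_delta θ).mul (hasDerivAt_subDenom θ)) (mul_pos hw hd).ne'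
  convert! h using 1
  simp only [Pi.mul_apply, Pi.neg_apply, cubeRootSub]
  have h3 := sqrt_three_sq
  have hsc := Real.sin_sq_add_cos_sq θ
  have hws := delta_sq θ
  have hdd : subDenom θ = (√3 + 1) - (√3 - 1) * Real.cos θ := rfl
  field_simp
  generalize delta θ = w at *
  generalize subDenom θ = d at *
  generalize √3 = r at *
  generalize Real.sin θ = s at *
  generalize Real.cos θ = c at *
  grind

end EquianharmonicSubstitution

section SingularModulus

lemma pi_mul_hyperHalf_zero_singular :
    π * hyperHalf 0 ((2 - √3) / 4) = ∫ θ in 0..π, 1 / delta θ := by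
  have h1 := one_lt_sqrt_three
  have h2 := sqrt_three_lt_two
  rw [pi_mul_hyperHalf 0 (by rw [abs_lt]; constructor <;> linarith)]
  refine intervalIntegral.integral_congr fun θ _ => ?_
  have := delta_radicand_pos θ
  exact euler_binomCoeff_half_zero (mul_nonneg (by linarith) (sq_nonneg _)) (by linarith)

lemma pi_mul_hyperHalf_one_singular :
    π * hyperHalf 1 ((2 - √3) / 4) =
      (2 - √3) / 8 * ∫ θ in 0..π, Real.sin θ ^ 2 / delta θ ^ 3 := by
  have h1 := one_lt_sqrt_three
  have h2 := sqrt_three_lt_two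
  rw [pi_mul_hyperHalf 1 (by rw [abs_lt]; constructor <;> linarith),
    ← intervalIntegral.integral_const_mul]
  refine intervalIntegral.integral_congr fun θ _ => ?_
  have := delta_radicand_pos θ
  refine (euler_binomCoeff_half_one (mul_nonneg (by linarith) (sq_nonneg _))
    (by linarith)).trans ?_
  have hw := delta_pos θ
  rw [← delta]
  field_simp
  ring

lemma integral_cubeRootSub_sq :
    ∫ θ in 0..π, cubeRootSub θ ^ 2 / delta θ =
      π / 4 * (hyperHalf 0 ((2 - √3) / 4) + (6 + 4 * √3) * hyperHalf 1 ((2 - √3) / 4)) := by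
  have hne : ∀ θ, delta θ ≠ 0 := fun θ => (delta_pos θ).ne'
  have c1 : Continuous fun θ => 1 / delta θ := continuous_const.div continuous_delta hne
  have c2 : Continuous fun θ => √3 / 4 * (Real.sin θ ^ 2 / delta θ ^ 3) :=
    continuous_const.mul ((Real.continuous_sin.pow 2).div (continuous_delta.pow 3)
      fun θ => pow_ne_zero 3 (hne θ))
  have c3 : Continuous fun θ => 4 * (cubeRootSub θ ^ 2 / delta θ) :=
    continuous_const.mul ((continuous_cubeRootSub.pow 2).div continuous_delta hne)
  have c4 : Continuous fun θ => 1 / delta θ + √3 / 4 * (Real.sin θ ^ 2 / delta θ ^ 3) := c1.add c2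
  have key := intervalIntegral.integral_eq_sub_of_hasDerivAt (a := 0) (b := π)
    (f := legendrePrimitive)
    (f' := fun θ => 1 / delta θ + √3 / 4 * (Real.sin θ ^ 2 / delta θ ^ 3)
      - 4 * (cubeRootSub θ ^ 2 / delta θ))
    (fun θ _ => by
      convert! hasDerivAt_legendrePrimitive θ using 1
      ring) ((c4.sub c3).intervalIntegrable _ _)
  rw [intervalIntegral.integral_sub (c4.intervalIntegrable _ _)
      (c3.intervalIntegrable _ _),
    intervalIntegral.integral_add (c1.intervalIntegrable _ _) (c2.intervalIntegrable _ _),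
    intervalIntegral.integral_const_mul, intervalIntegral.integral_const_mul,
    ← pi_mul_hyperHalf_zero_singular] at key
  simp only [legendrePrimitive, Real.sin_pi, Real.sin_zero, zero_mul, neg_zero, zero_div,
    sub_zero] at key
  have h3 := sqrt_three_sq
  linear_combination (-1 / 4) * key - (6 + 4 * √3) / 4 * pi_mul_hyperHalf_one_singular
    + (∫ θ in 0..π, Real.sin θ ^ 2 / delta θ ^ 3) / 8 * h3

lemma legendre_relation_singular :
    hyperHalf 0 ((2 - √3) / 4) *
      (hyperHalf 0 ((2 - √3) / 4) + (6 + 4 * √3) * hyperHalf 1 ((2 - √3) / 4)) = 4 / π := by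
  have b1 := beta_half_eq_integral (a := 1 / 6) (by norm_num)
  have b2 := beta_half_eq_integral (a := 5 / 6) (by norm_num)
  have b3 := beta_sixth_mul_beta_five_sixths
  rw [show (3 * (1 / 6) - 1 / 2 : ℝ) = 0 by norm_num] at b1
  rw [show (3 * (5 / 6) - 1 / 2 : ℝ) = (2 : ℕ) by norm_num] at b2
  simp only [Real.rpow_zero, Real.rpow_natCast] at b1 b2
  rw [← pi_mul_hyperHalf_zero_singular] at b1
  rw [integral_cubeRootSub_sq] at b2
  rw [b1, b2] at b3
  have hk : √(√3) ^ 2 = √(3 : ℝ) := Real.sq_sqrt (Real.sqrt_nonneg 3)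
  have h5 : 0 < √(√(3 : ℝ)) := by positivity
  have h3 := sqrt_three_sq
  have hp := pi_pos
  generalize hyperHalf 0 ((2 - √3) / 4) = X at *
  generalize hyperHalf 1 ((2 - √3) / 4) = Y at *
  field_simp at b3 ⊢
  rw [hk] at b3
  linear_combination b3 / 3 + 4 / 3 * h3

end SingularModulus

theorem stmt16 :
    HasSum (fun n : ℕ => (-(26 - 15 * Real.sqrt 3) / 16) ^ n *
      ((30 - 6 * Real.sqrt 3) * n + 7 - 3 * Real.sqrt 3) * (poch (1/2) n ^ 3 / poch 1 n ^ 3))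
      (4 * Real.sqrt 2 / Real.pi) := by
  have h3 := sqrt_three_sq
  have h1 := one_lt_sqrt_three
  have h2 := sqrt_three_lt_two
  have hx0 : 0 < (2 - √3) / 4 := by linarith
  have hx1 : (2 - √3) / 4 < 1 / 2 := by linarith
  have hne : 2 + √3 ≠ 0 := by positivity
  have hz : quadMap ((2 - √3) / 4) = -(26 - 15 * √3) / 16 := by
    rw [quadMap, show 4 * (1 - (2 - √3) / 4) = 2 + √3 by ring, div_eq_div_iff hne (by norm_num)]
    linear_combination -16 * h3
  have q0 := hyperQuarter_quadMap hx0 hx1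
  have q1 := hyperQuarter_one_quadMap hx0 hx1
  have hsum := hasSum_clausen (abs_quadMap_lt_one hx0.le hx1) (30 - 6 * √3) (7 - 3 * √3)
  have hrel := legendre_relation_singular
  have hpow : ((1 - (2 - √3) / 4) ^ (1 / 4 : ℝ)) ^ 2 = √2 * (√3 + 1) / 4 := by
    rw [← Real.rpow_natCast, ← Real.rpow_mul (by linarith),
      show (1 / 4 * (2 : ℕ) : ℝ) = 1 / 2 by norm_num, ← Real.sqrt_eq_rpow,
      Real.sqrt_eq_iff_mul_self_eq (by linarith) (by positivity)]
    have h2' : √2 ^ 2 = (2 : ℝ) := Real.sq_sqrt (by norm_num)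
    grind
  change HasSum _ (hyperQuarter 0 _ * (2 * _ * hyperQuarter 1 _ + _ * hyperQuarter 0 _)) at hsum
  rw [hz] at q0 q1 hsum
  have q1' : hyperQuarter 1 (-(26 - 15 * √3) / 16) = (1 - (2 - √3) / 4) ^ (1 / 4 : ℝ) *
      ((9 + 4 * √3) / 33 * hyperHalf 1 ((2 - √3) / 4)
        - (15 - 8 * √3) / 132 * hyperHalf 0 ((2 - √3) / 4)) := by
    generalize (1 - (2 - √3) / 4) ^ (1 / 4 : ℝ) = p at q1 ⊢
    rw [show 1 - (2 - √3) / 4 = (2 + √3) / 4 by ring,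
      show 2 - (2 - √3) / 4 = (6 + √3) / 4 by ring] at q1
    field_simp at q1 ⊢
    grind
  rw [q0, q1'] at hsum
  convert! hsum using 1
  · ext n
    rw [binomCoeff, div_pow]
    ring
  · generalize (1 - (2 - √3) / 4) ^ (1 / 4 : ℝ) = p at *
    rw [mul_div_right_comm, ← hrel]
    clear * - h3 hpow
    generalize hyperHalf 0 ((2 - √3) / 4) = X
    generalize hyperHalf 1 ((2 - √3) / 4) = Y
    grind
end

section
/- For all real b, c ≥ 0 with (b,c) ≠ (0,0) or b+1 > 0, ∫₀^{π/2} K(√(4c tanθ / (b² + (c+tanθ)²))) · sinθ / √(b² + (c+tanθ)²) dθ = π / (2√((b+1)² + c²)). -/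
open MeasureTheory Real Filter

open scoped ENNReal Topology

/-- The fundamental theorem of calculus on `(0, ∞)` for nonnegative derivatives, in `lintegral`
form. -/
theorem lintegral_Ioi_of_hasDerivAt {f f' : ℝ → ℝ} {a l : ℝ}
    (hderiv : ∀ x, 0 ≤ x → HasDerivAt f (f' x) x) (hpos : ∀ x, 0 < x → 0 ≤ f' x)
    (h0 : f 0 = a) (hlim : Tendsto f atTop (𝓝 l)) :
    ∫⁻ x in Set.Ioi (0 : ℝ), ENNReal.ofReal (f' x) = ENNReal.ofReal (l - a) := by
  have hint : IntegrableOn f' (Set.Ioi 0) :=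
    integrableOn_Ioi_deriv_of_nonneg' (fun x hx => hderiv x hx) (fun x hx => hpos x hx) hlim
  rw [← ofReal_integral_eq_lintegral_ofReal hint
    ((ae_restrict_mem measurableSet_Ioi).mono fun x hx => hpos x hx),
    integral_Ioi_of_hasDerivAt_of_nonneg' (fun x hx => hderiv x hx) (fun x hx => hpos x hx) hlim,
    h0]

theorem image_tan_Ioo_zero : Real.tan '' Set.Ioo 0 (π / 2) = Set.Ioi 0 := by
  ext t
  constructor
  · rintro ⟨x, hx, rfl⟩
    exact Real.tan_pos_of_pos_of_lt_pi_div_two hx.1 hx.2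
  · intro ht
    exact ⟨Real.arctan t, ⟨Real.arctan_pos.2 ht, Real.arctan_lt_pi_div_two t⟩,
      Real.tan_arctan t⟩

/-- The substitution `t = tan θ` on `(0, π/2)`. -/
theorem lintegral_comp_tan (g : ℝ → ℝ≥0∞) :
    ∫⁻ θ in Set.Ioo 0 (π / 2), ENNReal.ofReal (1 / Real.cos θ ^ 2) * g (Real.tan θ) =
      ∫⁻ t in Set.Ioi (0 : ℝ), g t := by
  have hcos : ∀ x ∈ Set.Ioo 0 (π / 2), 0 < Real.cos x := fun x hx =>
    Real.cos_pos_of_mem_Ioo ⟨by linarith [hx.1, Real.pi_pos], hx.2⟩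
  have h := lintegral_image_eq_lintegral_abs_deriv_mul (s := Set.Ioo 0 (π / 2))
    (f := Real.tan) (f' := fun x => 1 / Real.cos x ^ 2) measurableSet_Ioo
    (fun x hx => (Real.hasDerivAt_tan (hcos x hx).ne').hasDerivWithinAt)
    (Real.injOn_tan.mono (Set.Ioo_subset_Ioo_left (by linarith [Real.pi_pos]))) g
  rw [image_tan_Ioo_zero] at h
  rw [h]
  refine setLIntegral_congr_fun measurableSet_Ioo fun x _ => ?_
  simp only [abs_of_nonneg (by positivity : (0 : ℝ) ≤ 1 / Real.cos x ^ 2)]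

theorem tendsto_arctan_mul_atTop {r : ℝ} (hr : 0 < r) :
    Tendsto (fun x => Real.arctan (r * x)) atTop (𝓝 (π / 2)) :=
  (Real.tendsto_arctan_atTop.mono_right nhdsWithin_le_nhds).comp
    (tendsto_id.const_mul_atTop hr)

theorem lintegral_Ioi_quadratic_div_sq {m n p s : ℝ} (hm : 0 ≤ m) (hn : 0 ≤ n)
    (hp : 0 < p) (hs : 0 < s) :
    ∫⁻ u in Set.Ioi (0 : ℝ), ENNReal.ofReal ((m + n * u ^ 2) / (p ^ 2 + s ^ 2 * u ^ 2) ^ 2) =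
      ENNReal.ofReal (π / 4 * (m / p ^ 2 + n / s ^ 2) / (p * s)) := by
  have hden : ∀ u : ℝ, 0 < p ^ 2 + s ^ 2 * u ^ 2 := fun u => by positivity
  have key := lintegral_Ioi_of_hasDerivAt (a := 0)
    (l := (m / p ^ 2 - n / s ^ 2) / 2 * 0 + (m / p ^ 2 + n / s ^ 2) / 2 / (p * s) * (π / 2))
    (f := fun u => (m / p ^ 2 - n / s ^ 2) / 2 * (u / (p ^ 2 + s ^ 2 * u ^ 2)) +
      (m / p ^ 2 + n / s ^ 2) / 2 / (p * s) * Real.arctan (s / p * u))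
    (f' := fun u => (m + n * u ^ 2) / (p ^ 2 + s ^ 2 * u ^ 2) ^ 2) ?_ ?_ ?_ ?_
  · rw [key]
    congr 1
    ring
  · intro u _
    have hd := hden u
    have h1 : HasDerivAt (fun u : ℝ => p ^ 2 + s ^ 2 * u ^ 2) (s ^ 2 * (2 * u)) u := by
      simpa using ((hasDerivAt_pow 2 u).const_mul (s ^ 2)).const_add (p ^ 2)
    have h2 := (hasDerivAt_id u).div h1 hd.ne'
    have h3 := ((hasDerivAt_id u).const_mul (s / p)).arctan
    have h4 := (h2.const_mul ((m / p ^ 2 - n / s ^ 2) / 2)).add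
      (h3.const_mul ((m / p ^ 2 + n / s ^ 2) / 2 / (p * s)))
    refine h4.congr_deriv ?_
    have h5 : 1 + (s / p * u) ^ 2 = (p ^ 2 + s ^ 2 * u ^ 2) / p ^ 2 := by field_simp
    simp only [id, h5]
    field_simp
    ring
  · intro u _
    positivity
  · simp
  · refine Tendsto.add (Tendsto.const_mul _ ?_) ((tendsto_arctan_mul_atTop (by positivity)).const_mul _)
    have h1 : Tendsto (fun u : ℝ => (s ^ 2)⁻¹ * u⁻¹) atTop (𝓝 0) := by
      simpa using tendsto_inv_atTop_zero.const_mul ((s ^ 2)⁻¹)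
    refine squeeze_zero' (g := fun u : ℝ => (s ^ 2)⁻¹ * u⁻¹) ?_ ?_ h1
    · filter_upwards [eventually_gt_atTop 0] with u hu
      positivity
    · filter_upwards [eventually_gt_atTop 0] with u hu
      rw [← mul_inv, ← one_div, div_le_div_iff₀ (hden u) (by positivity)]
      nlinarith [sq_nonneg p]

theorem lintegral_Ioi_inv_mul_quadratic {r s : ℝ} (hr : 0 < r) (hs : 0 ≤ s) (hsr : s < r) :
    ∫⁻ q in Set.Ioi (0 : ℝ),
        ENNReal.ofReal (1 / ((1 + r ^ 2 * q ^ 2) * (1 + s ^ 2 * q ^ 2))) =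
      ENNReal.ofReal (π / (2 * (r + s))) := by
  have hrs : r ^ 2 - s ^ 2 ≠ 0 := by nlinarith
  have hd : ∀ a q : ℝ, 1 + a ^ 2 * q ^ 2 ≠ 0 := fun a q => by positivity
  have key := lintegral_Ioi_of_hasDerivAt (a := 0)
    (l := (r * (π / 2) - s * (π / 2)) / (r ^ 2 - s ^ 2))
    (f := fun q => (r * Real.arctan (r * q) - s * Real.arctan (s * q)) / (r ^ 2 - s ^ 2))
    (f' := fun q => 1 / ((1 + r ^ 2 * q ^ 2) * (1 + s ^ 2 * q ^ 2))) ?_ ?_ ?_ ?_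
  · rw [key]
    congr 1
    have : r + s ≠ 0 := by positivity
    field_simp
    ring
  · intro q _
    have h (a : ℝ) := (((hasDerivAt_id q).const_mul a).arctan).const_mul a
    refine (((h r).sub (h s)).div_const _).congr_deriv ?_
    have := hd r q
    have := hd s q
    simp only [id, mul_pow]
    field_simp
    ring
  · intro q _
    positivity
  · simp
  · refine Tendsto.div_const (((tendsto_arctan_mul_atTop hr).const_mul _).sub ?_) _
    rcases hs.eq_or_lt with rfl | hs
    · simp
    · exact (tendsto_arctan_mul_atTop hs).const_mul _

theorem lintegral_Ioi_inv_quartic {b c : ℝ} (hb : 0 ≤ b) :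
    ∫⁻ q in Set.Ioi (0 : ℝ),
        ENNReal.ofReal (1 / ((1 + q ^ 2) * (1 + b ^ 2 * q ^ 2) + c ^ 2 * q ^ 2)) =
      ENNReal.ofReal (π / (2 * √((b + 1) ^ 2 + c ^ 2))) := by
  set U := √((b + 1) ^ 2 + c ^ 2) with hU
  set V := √((b - 1) ^ 2 + c ^ 2) with hV
  have hU2 : U ^ 2 = (b + 1) ^ 2 + c ^ 2 := Real.sq_sqrt (by positivity)
  have hV2 : V ^ 2 = (b - 1) ^ 2 + c ^ 2 := Real.sq_sqrt (by positivity)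
  have hU0 : 0 < U := Real.sqrt_pos.2 (by positivity)
  have hVU : V ≤ U := Real.sqrt_le_sqrt (by nlinarith)
  have hprod : ((U + V) / 2) * ((U - V) / 2) = b := by nlinarith
  have hsum : ((U + V) / 2) ^ 2 + ((U - V) / 2) ^ 2 = 1 + b ^ 2 + c ^ 2 := by nlinarith
  rcases (Real.sqrt_nonneg _ : 0 ≤ V).eq_or_lt with h0 | h0
  · have hb1 : b = 1 := by nlinarith [sq_nonneg (b - 1), sq_nonneg c]
    have hc0 : c = 0 := by
      have : c ^ 2 = 0 := by nlinarith [sq_nonneg (b - 1), sq_nonneg c]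
      simpa using this
    have hU' : U = 2 := by
      rw [hb1, hc0] at hU2
      nlinarith
    have h := lintegral_Ioi_quadratic_div_sq (m := 1) (n := 0) (p := 1) (s := 1)
      zero_le_one le_rfl one_pos one_pos
    rw [hU', hb1, hc0]
    convert h using 1
    · refine lintegral_congr fun q => ?_
      congr 1
      ring
    · congr 1
      ring
  · have h := lintegral_Ioi_inv_mul_quadratic (r := (U + V) / 2) (s := (U - V) / 2)
      (by positivity) (by linarith) (by linarith)
    convert h using 4
    · rename_i q
      congr 1
      have : b ^ 2 = (((U + V) / 2) * ((U - V) / 2)) ^ 2 := by rw [hprod]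
      linear_combination (q ^ 2) * (-hsum) + q ^ 4 * this
    · ring

theorem lintegral_Ioi_radial {E D k : ℝ} (hE : 0 < E) (hD : 0 < D) (hkED : k < E * D)
    {Q : ℝ → ℝ} (hQ : ∀ t, Q t = E ^ 2 * t ^ 4 + 2 * (E * D - 2 * k) * t ^ 2 + D ^ 2) :
    ∫⁻ t in Set.Ioi (0 : ℝ), ENNReal.ofReal (t * (E * t ^ 2 + D) / (Q t * √(Q t))) =
      ENNReal.ofReal (1 / (2 * (E * D - k))) := by
  have hW : 0 < E * D - k := by linarith
  have hQpos : ∀ t, 0 < Q t := fun t => by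
    rw [hQ]
    rcases eq_or_ne t 0 with rfl | ht
    · simpa using pow_pos hD 2
    · nlinarith [mul_pos hW (pow_pos (sq_pos_of_ne_zero ht) 1), sq_nonneg (E * t ^ 2 - D)]
  have key := lintegral_Ioi_of_hasDerivAt (a := -(1 / (4 * (E * D - k))))
    (l := 1 / (4 * (E * D - k)))
    (f := fun t => (E * t ^ 2 - D) / √(Q t) * (1 / (4 * (E * D - k))))
    (f' := fun t => t * (E * t ^ 2 + D) / (Q t * √(Q t))) ?_ ?_ ?_ ?_
  · rw [key]
    congr 1
    field_simp
    ring
  · intro t _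
    have hq := hQpos t
    have hr : 0 < √(Q t) := Real.sqrt_pos.2 hq
    have h1 : HasDerivAt Q (E ^ 2 * (4 * t ^ 3) + 2 * (E * D - 2 * k) * (2 * t)) t := by
      rw [show Q = fun t => E ^ 2 * t ^ 4 + 2 * (E * D - 2 * k) * t ^ 2 + D ^ 2 from funext hQ]
      simpa using (((hasDerivAt_pow 4 t).const_mul (E ^ 2)).add
        ((hasDerivAt_pow 2 t).const_mul (2 * (E * D - 2 * k)))).add_const (D ^ 2)
    have h2 : HasDerivAt (fun t : ℝ => E * t ^ 2 - D) (E * (2 * t)) t := by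
      simpa using ((hasDerivAt_pow 2 t).const_mul E).sub_const D
    refine ((h2.div (h1.sqrt hq.ne') hr.ne').mul_const _).congr_deriv ?_
    have h3 : √(Q t) ^ 2 = Q t := Real.sq_sqrt hq.le
    generalize √(Q t) = y at *
    rw [← h3]
    field_simp
    rw [h3, hQ]
    ring
  · intro t ht
    have := hQpos t
    positivity
  · have : Q 0 = D ^ 2 := by rw [hQ]; ring
    simp only [this, Real.sqrt_sq hD.le]
    field_simp
    ring
  · have hl : (E - D * 0) / √(E ^ 2 + 2 * (E * D - 2 * k) * 0 + D ^ 2 * 0 ^ 2) *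
        (1 / (4 * (E * D - k))) = 1 / (4 * (E * D - k)) := by
      simp [Real.sqrt_sq hE.le, hE.ne']
    have h1 : Tendsto (fun t : ℝ => (t ^ 2)⁻¹) atTop (𝓝 0) :=
      tendsto_inv_atTop_zero.comp (tendsto_pow_atTop two_ne_zero)
    have h2 : Tendsto (fun t : ℝ => (E - D * (t ^ 2)⁻¹) /
        √(E ^ 2 + 2 * (E * D - 2 * k) * (t ^ 2)⁻¹ + D ^ 2 * ((t ^ 2)⁻¹) ^ 2) *
          (1 / (4 * (E * D - k)))) atTop
        (𝓝 ((E - D * 0) / √(E ^ 2 + 2 * (E * D - 2 * k) * 0 + D ^ 2 * 0 ^ 2) *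
          (1 / (4 * (E * D - k))))) := by
      refine Tendsto.mul_const _ (Tendsto.div ((h1.const_mul D).const_sub E) ?_ ?_)
      · exact ((((h1.const_mul _).const_add _).add ((h1.pow 2).const_mul _))).sqrt
      · simp [Real.sqrt_sq hE.le, hE.ne']
    rw [hl] at h2
    refine h2.congr' ?_
    filter_upwards [eventually_gt_atTop 0] with t ht
    have h3 : Q t = (E ^ 2 + 2 * (E * D - 2 * k) * (t ^ 2)⁻¹ + D ^ 2 * ((t ^ 2)⁻¹) ^ 2)
        * (t ^ 2) ^ 2 := by
      rw [hQ]
      field_simp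
    rw [h3, Real.sqrt_mul' _ (by positivity), Real.sqrt_sq (by positivity)]
    congr 1
    rw [div_mul_eq_div_div_swap]
    congr 1
    field_simp

/-- The planar integral `∫∫ t / (q² (b² + |c + t e^{2iψ}|²) + 1 + t²)² dψ dt` after the
substitution `u = tan ψ`. -/
theorem lintegral_Ioi_Ioi_planar (b c q : ℝ) :
    ∫⁻ t in Set.Ioi (0 : ℝ), ∫⁻ u in Set.Ioi (0 : ℝ),
        ENNReal.ofReal (4 / π * t * (1 + u ^ 2) /
          ((q ^ 2 * (b ^ 2 + (c + t) ^ 2) + 1 + t ^ 2) +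
            (q ^ 2 * (b ^ 2 + (c - t) ^ 2) + 1 + t ^ 2) * u ^ 2) ^ 2) =
      ENNReal.ofReal (1 / ((1 + q ^ 2) * (1 + b ^ 2 * q ^ 2) + c ^ 2 * q ^ 2)) := by
  have hrad := lintegral_Ioi_radial (E := 1 + q ^ 2) (D := q ^ 2 * (b ^ 2 + c ^ 2) + 1)
    (k := q ^ 4 * c ^ 2) (by positivity) (by positivity)
    (by
      have : (1 + q ^ 2) * (q ^ 2 * (b ^ 2 + c ^ 2) + 1) - q ^ 4 * c ^ 2 =
        (1 + q ^ 2) * (1 + b ^ 2 * q ^ 2) + c ^ 2 * q ^ 2 := by ring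
      have : 0 < (1 + q ^ 2) * (1 + b ^ 2 * q ^ 2) + c ^ 2 * q ^ 2 := by positivity
      linarith)
    (Q := fun t => (q ^ 2 * (b ^ 2 + (c + t) ^ 2) + 1 + t ^ 2) *
      (q ^ 2 * (b ^ 2 + (c - t) ^ 2) + 1 + t ^ 2)) (fun t => by ring)
  have hinner : ∀ t ∈ Set.Ioi (0 : ℝ), ∫⁻ u in Set.Ioi (0 : ℝ),
        ENNReal.ofReal (4 / π * t * (1 + u ^ 2) /
          ((q ^ 2 * (b ^ 2 + (c + t) ^ 2) + 1 + t ^ 2) +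
            (q ^ 2 * (b ^ 2 + (c - t) ^ 2) + 1 + t ^ 2) * u ^ 2) ^ 2) =
      ENNReal.ofReal 2 * ENNReal.ofReal (t * ((1 + q ^ 2) * t ^ 2 + (q ^ 2 * (b ^ 2 + c ^ 2) + 1)) /
        (((q ^ 2 * (b ^ 2 + (c + t) ^ 2) + 1 + t ^ 2) *
          (q ^ 2 * (b ^ 2 + (c - t) ^ 2) + 1 + t ^ 2)) *
        √((q ^ 2 * (b ^ 2 + (c + t) ^ 2) + 1 + t ^ 2) *
          (q ^ 2 * (b ^ 2 + (c - t) ^ 2) + 1 + t ^ 2)))) := by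
    intro t ht
    have ht : 0 < t := ht
    have hsum : (1 + q ^ 2) * t ^ 2 + (q ^ 2 * (b ^ 2 + c ^ 2) + 1) =
      ((q ^ 2 * (b ^ 2 + (c + t) ^ 2) + 1 + t ^ 2) +
        (q ^ 2 * (b ^ 2 + (c - t) ^ 2) + 1 + t ^ 2)) / 2 := by ring
    rw [hsum]
    have hP : 0 < q ^ 2 * (b ^ 2 + (c + t) ^ 2) + 1 + t ^ 2 := by positivity
    have hS : 0 < q ^ 2 * (b ^ 2 + (c - t) ^ 2) + 1 + t ^ 2 := by positivity
    generalize q ^ 2 * (b ^ 2 + (c + t) ^ 2) + 1 + t ^ 2 = P at *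
    generalize q ^ 2 * (b ^ 2 + (c - t) ^ 2) + 1 + t ^ 2 = S at *
    have hp := Real.sqrt_pos.2 hP
    have hs := Real.sqrt_pos.2 hS
    have h := lintegral_Ioi_quadratic_div_sq (m := 1) (n := 1) zero_le_one zero_le_one hp hs
    rw [Real.sq_sqrt hP.le, Real.sq_sqrt hS.le] at h
    rw [Real.sqrt_mul hP.le]
    calc _ = ∫⁻ u in Set.Ioi (0 : ℝ), ENNReal.ofReal (4 / π * t) *
          ENNReal.ofReal ((1 + 1 * u ^ 2) / (P + S * u ^ 2) ^ 2) := by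
            refine lintegral_congr fun u => ?_
            rw [← ENNReal.ofReal_mul (by positivity), one_mul, mul_div_assoc]
      _ = _ := by
            rw [lintegral_const_mul' _ _ ENNReal.ofReal_ne_top, h,
              ← ENNReal.ofReal_mul (by positivity), ← ENNReal.ofReal_mul (by positivity)]
            congr 1
            field_simp
            ring
  rw [setLIntegral_congr_fun measurableSet_Ioi hinner,
    lintegral_const_mul' _ _ ENNReal.ofReal_ne_top, hrad, ← ENNReal.ofReal_mul (by positivity)]
  congr 1
  rw [show (1 + q ^ 2) * (1 + b ^ 2 * q ^ 2) + c ^ 2 * q ^ 2 =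
    (1 + q ^ 2) * (q ^ 2 * (b ^ 2 + c ^ 2) + 1) - q ^ 4 * c ^ 2 by ring, one_div, one_div,
    mul_inv, mul_inv_cancel_left₀ two_ne_zero]

theorem lintegral_Ioi_Ioi_potential {b c : ℝ} (hb : 0 ≤ b) (hc : 0 ≤ c) :
    ∫⁻ t in Set.Ioi (0 : ℝ), ∫⁻ u in Set.Ioi (0 : ℝ),
        ENNReal.ofReal (t / (√(1 + t ^ 2) ^ 3 * (1 + u ^ 2) *
          √(b ^ 2 + (c + t) ^ 2 - 4 * c * t * (u ^ 2 / (1 + u ^ 2))))) =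
      ENNReal.ofReal (π / (2 * √((b + 1) ^ 2 + c ^ 2))) := by
  rw [← lintegral_Ioi_inv_quartic hb, ← lintegral_congr fun q => lintegral_Ioi_Ioi_planar b c q]
  symm
  rw [lintegral_lintegral_swap (by
    refine Measurable.aemeasurable ?_
    refine Measurable.lintegral_prod_right' (ν := volume.restrict (Set.Ioi (0 : ℝ)))
      (f := fun z : (ℝ × ℝ) × ℝ =>
      ENNReal.ofReal (4 / π * z.1.2 * (1 + z.2 ^ 2) /
          ((z.1.1 ^ 2 * (b ^ 2 + (c + z.1.2) ^ 2) + 1 + z.1.2 ^ 2) +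
            (z.1.1 ^ 2 * (b ^ 2 + (c - z.1.2) ^ 2) + 1 + z.1.2 ^ 2) * z.2 ^ 2) ^ 2)) ?_
    fun_prop)]
  refine setLIntegral_congr_fun measurableSet_Ioi fun t ht => ?_
  have ht : 0 < t := ht
  rw [lintegral_lintegral_swap (by
    refine Measurable.aemeasurable ?_
    unfold Function.uncurry
    fun_prop)]
  refine lintegral_congr fun u => ?_
  set A := b ^ 2 + (c + t) ^ 2 - 4 * c * t * (u ^ 2 / (1 + u ^ 2)) with hA
  have hu : 0 < 1 + u ^ 2 := by positivity
  have hA' : A * (1 + u ^ 2) = b ^ 2 + (c + t) ^ 2 + (b ^ 2 + (c - t) ^ 2) * u ^ 2 := by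
    rw [hA]
    field_simp
    ring
  have hA0 : 0 < A := by
    have : 0 < A * (1 + u ^ 2) := by rw [hA']; positivity
    exact pos_of_mul_pos_left this hu.le
  have hB0 : 0 < 1 + t ^ 2 := by positivity
  have hs := Real.sqrt_pos.2 hA0
  have hp := Real.sqrt_pos.2 hB0
  have h := lintegral_Ioi_quadratic_div_sq (m := 1) (n := 0) zero_le_one le_rfl hp hs
  rw [Real.sq_sqrt hA0.le, Real.sq_sqrt hB0.le] at h
  calc _ = ∫⁻ q in Set.Ioi (0 : ℝ), ENNReal.ofReal (4 / π * t / (1 + u ^ 2)) *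
        ENNReal.ofReal ((1 + 0 * q ^ 2) / (1 + t ^ 2 + A * q ^ 2) ^ 2) := by
          refine lintegral_congr fun q => ?_
          rw [← ENNReal.ofReal_mul (by positivity)]
          congr 1
          rw [show q ^ 2 * (b ^ 2 + (c + t) ^ 2) + 1 + t ^ 2 +
            (q ^ 2 * (b ^ 2 + (c - t) ^ 2) + 1 + t ^ 2) * u ^ 2 =
              (1 + t ^ 2 + A * q ^ 2) * (1 + u ^ 2) by linear_combination (-q ^ 2) * hA']
          have : 0 < 1 + t ^ 2 + A * q ^ 2 := by positivity
          field_simp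
          ring
    _ = _ := by
          rw [lintegral_const_mul' _ _ ENNReal.ofReal_ne_top, h,
            ← ENNReal.ofReal_mul (by positivity)]
          congr 1
          have h3 : √(1 + t ^ 2) ^ 3 = (1 + t ^ 2) * √(1 + t ^ 2) := by
            rw [pow_succ, Real.sq_sqrt hB0.le]
          rw [h3]
          field_simp
          ring

theorem lintegral_Ioo_Ioo_potential {b c : ℝ} (hb : 0 ≤ b) (hc : 0 ≤ c) :
    ∫⁻ θ in Set.Ioo 0 (π / 2), ∫⁻ ψ in Set.Ioo 0 (π / 2),
        ENNReal.ofReal (Real.sin θ /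
          √(b ^ 2 + (c + Real.tan θ) ^ 2 - 4 * c * Real.tan θ * Real.sin ψ ^ 2)) =
      ENNReal.ofReal (π / (2 * √((b + 1) ^ 2 + c ^ 2))) := by
  rw [← lintegral_Ioi_Ioi_potential hb hc, ← lintegral_comp_tan]
  refine setLIntegral_congr_fun measurableSet_Ioo fun θ hθ => ?_
  rw [← lintegral_comp_tan, ← lintegral_const_mul' _ _ ENNReal.ofReal_ne_top]
  refine setLIntegral_congr_fun measurableSet_Ioo fun ψ hψ => ?_
  have hcos : ∀ x ∈ Set.Ioo 0 (π / 2), 0 < Real.cos x := fun x hx =>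
    Real.cos_pos_of_mem_Ioo ⟨by linarith [hx.1, Real.pi_pos], hx.2⟩
  have hcθ := hcos θ hθ
  have hcψ := hcos ψ hψ
  have h1 : ∀ x, 0 < Real.cos x → 1 + Real.tan x ^ 2 = 1 / Real.cos x ^ 2 := fun x hx => by
    rw [Real.tan_eq_sin_div_cos]
    field_simp
    linarith [Real.sin_sq_add_cos_sq x]
  have h2 : √(1 + Real.tan θ ^ 2) = 1 / Real.cos θ := by
    rw [h1 θ hcθ, ← one_div_pow, Real.sqrt_sq (by positivity)]
  have h3 : Real.tan ψ ^ 2 / (1 + Real.tan ψ ^ 2) = Real.sin ψ ^ 2 := by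
    rw [h1 ψ hcψ, Real.tan_eq_sin_div_cos]
    field_simp
  rw [← ENNReal.ofReal_mul (by positivity), ← ENNReal.ofReal_mul (by positivity), h3, h2,
    h1 ψ hcψ]
  congr 1
  rw [← Real.tan_mul_cos hcθ.ne']
  generalize √(b ^ 2 + (c + Real.tan θ) ^ 2 - 4 * c * Real.tan θ * Real.sin ψ ^ 2) = y
  generalize Real.tan θ = t
  rcases eq_or_ne y 0 with rfl | hy
  · simp
  · field_simp

theorem K_mul_sin_div_sqrt {b c θ : ℝ} (hc : 0 ≤ c) (hθ : θ ∈ Set.Ioo 0 (π / 2)) :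
    K (√(4 * c * Real.tan θ / (b ^ 2 + (c + Real.tan θ) ^ 2))) *
        Real.sin θ / √(b ^ 2 + (c + Real.tan θ) ^ 2) =
      (∫⁻ ψ in Set.Ioo 0 (π / 2), ENNReal.ofReal (Real.sin θ /
        √(b ^ 2 + (c + Real.tan θ) ^ 2 - 4 * c * Real.tan θ * Real.sin ψ ^ 2))).toReal := by
  have ht : 0 < Real.tan θ := Real.tan_pos_of_pos_of_lt_pi_div_two hθ.1 hθ.2
  have hs : 0 < Real.sin θ := Real.sin_pos_of_mem_Ioo ⟨hθ.1, by linarith [hθ.2, Real.pi_pos]⟩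
  rw [← integral_eq_lintegral_of_nonneg_ae (Eventually.of_forall fun ψ => by positivity)
    (by refine Measurable.aestronglyMeasurable ?_; fun_prop), mul_div_assoc, K,
    ← integral_mul_const]
  refine integral_congr_ae (Eventually.of_forall fun ψ => ?_)
  generalize Real.tan θ = t at *
  have hM : 0 < b ^ 2 + (c + t) ^ 2 := by positivity
  dsimp only
  rw [Real.sq_sqrt (by positivity), one_div_mul_eq_div, div_div, mul_comm,
    ← Real.sqrt_mul' _ hM.le]
  congr 2
  field_simp

theorem stmt17 (b c : ℝ) (hb : 0 ≤ b) (hc : 0 ≤ c)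
    (h : ¬(b = 0 ∧ c = 0) ∨ b + 1 > 0) :
    ∫ θ in (0:ℝ)..(Real.pi/2),
        K (Real.sqrt (4 * c * Real.tan θ / (b ^ 2 + (c + Real.tan θ) ^ 2))) *
          Real.sin θ / Real.sqrt (b ^ 2 + (c + Real.tan θ) ^ 2) =
      Real.pi / (2 * Real.sqrt ((b + 1) ^ 2 + c ^ 2)) := by
  have hL := lintegral_Ioo_Ioo_potential hb hc
  have hmeas : Measurable fun θ => ∫⁻ ψ in Set.Ioo 0 (π / 2), ENNReal.ofReal (Real.sin θ /
      √(b ^ 2 + (c + Real.tan θ) ^ 2 - 4 * c * Real.tan θ * Real.sin ψ ^ 2)) := by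
    refine Measurable.lintegral_prod_right' (f := fun z : ℝ × ℝ => ENNReal.ofReal (Real.sin z.1 /
      √(b ^ 2 + (c + Real.tan z.1) ^ 2 - 4 * c * Real.tan z.1 * Real.sin z.2 ^ 2))) ?_
    simp only [Real.tan_eq_sin_div_cos]
    fun_prop
  rw [intervalIntegral.integral_of_le (by positivity), integral_Ioc_eq_integral_Ioo,
    setIntegral_congr_fun measurableSet_Ioo fun θ hθ => K_mul_sin_div_sqrt hc hθ,
    integral_toReal hmeas.aemeasurable
      (ae_lt_top hmeas (by rw [hL]; exact ENNReal.ofReal_ne_top)), hL,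
    ENNReal.toReal_ofReal (by positivity)]
end

section
/- For c > 0, ∫₀^∞ Re[K(x)] · c x / (1 + c²x²)^{3/2} dx = π / (2√(1+c²)), where K(x) for x > 1 is the analytic continuation of the complete elliptic integral of the first kind. -/
open MeasureTheory Real Filter

/-- Real part of the analytic continuation of `K` to positive real moduli:
for `x > 1`, `Re K(x) = (1/x) K(1/x)`. -/
noncomputable def KRe (x : ℝ) : ℝ := if x ≤ 1 then K x else (1 / x) * K (1 / x)

lemma rpow_three_halves {a : ℝ} (ha : 0 < a) : a ^ ((3:ℝ)/2) = a * √a := by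
  rw [show (3:ℝ)/2 = 1 + 1/2 by norm_num, rpow_add ha, rpow_one, sqrt_eq_rpow]

lemma one_div_sqrt_eq_zero_of_nonpos {a : ℝ} (ha : a ≤ 0) : 1 / √a = 0 := by
  rw [sqrt_eq_zero_of_nonpos ha, div_zero]

/-- The reciprocal modulus transformation. Outside `x * sin θ < 1` the integrand defining `K x`
vanishes by the conventions for `Real.sqrt` and division. -/
lemma K_eq_one_div_mul_K_one_div {x : ℝ} (hx : 1 < x) : K x = (1 / x) * K (1 / x) := by
  have hx0 : 0 < x := by linarith
  have hpi := pi_pos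
  have hmem : ∀ φ ∈ Set.Ioo 0 (π / 2), 0 < sin φ ∧ sin φ < 1 ∧ 0 < cos φ := by
    intro φ hφ
    have hs : 0 < sin φ := sin_pos_of_pos_of_lt_pi hφ.1 (by linarith [hφ.2])
    have hc : 0 < cos φ := cos_pos_of_mem_Ioo ⟨by linarith [hφ.1], hφ.2⟩
    exact ⟨hs, by nlinarith [sin_sq_add_cos_sq φ], hc⟩
  have hquot : ∀ φ ∈ Set.Ioo 0 (π / 2), 0 < sin φ / x ∧ sin φ / x < 1 := by
    intro φ hφ
    obtain ⟨hs, hs1, -⟩ := hmem φ hφ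
    exact ⟨by positivity, by rw [div_lt_one hx0]; linarith⟩
  have himage : (fun φ => arcsin (sin φ / x)) '' Set.Ioo 0 (π / 2) =
      Set.Ioo 0 (arcsin (1 / x)) := by
    ext θ
    constructor
    · rintro ⟨φ, hφ, rfl⟩
      obtain ⟨h0, h1⟩ := hquot φ hφ
      refine ⟨arcsin_pos.2 h0, ?_⟩
      apply arcsin_lt_arcsin (by linarith) _ (by rw [div_le_one hx0]; linarith)
      exact div_lt_div_of_pos_right (hmem φ hφ).2.1 hx0
    · rintro ⟨h0, h1⟩
      have hle : θ < π / 2 := h1.trans_le (arcsin_le_pi_div_two _)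
      have hs : 0 < sin θ := sin_pos_of_pos_of_lt_pi h0 (by linarith)
      have hlt : x * sin θ < 1 := by
        have := (lt_arcsin_iff_sin_lt' ⟨by linarith, hle⟩).1 h1
        rw [lt_div_iff₀ hx0] at this
        linarith
      refine ⟨arcsin (x * sin θ), ⟨arcsin_pos.2 (by positivity), arcsin_lt_pi_div_two.2 hlt⟩, ?_⟩
      have : 0 < x * sin θ := by positivity
      simp only
      rw [sin_arcsin (by linarith) hlt.le, mul_div_cancel_left₀ _ hx0.ne',
        arcsin_sin (by linarith) hle.le]
  have hsub : Set.Ioo 0 (arcsin (1 / x)) ⊆ Set.Ioo 0 (π / 2) :=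
    Set.Ioo_subset_Ioo_right (arcsin_le_pi_div_two _)
  have hrestrict : K x =
      ∫ θ in Set.Ioo 0 (arcsin (1 / x)), 1 / √(1 - x ^ 2 * sin θ ^ 2) := by
    apply setIntegral_eq_of_subset_of_forall_sdiff_eq_zero measurableSet_Ioo hsub
    rintro θ ⟨hθ, hθ'⟩
    have hle : arcsin (1 / x) ≤ θ := by
      by_contra! h
      exact hθ' ⟨hθ.1, h⟩
    have h1 := (arcsin_le_iff_le_sin' ⟨by linarith [hθ.1], hθ.2⟩).1 hle
    rw [div_le_iff₀ hx0] at h1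
    apply one_div_sqrt_eq_zero_of_nonpos
    nlinarith
  have hderiv : ∀ φ ∈ Set.Ioo 0 (π / 2),
      HasDerivWithinAt (fun φ => arcsin (sin φ / x))
        (1 / √(1 - (sin φ / x) ^ 2) * (cos φ / x)) (Set.Ioo 0 (π / 2)) φ := by
    intro φ hφ
    obtain ⟨h0, h1⟩ := hquot φ hφ
    exact ((hasDerivAt_arcsin (by linarith) (by linarith)).comp φ
      ((hasDerivAt_sin φ).div_const x)).hasDerivWithinAt
  have hinj : Set.InjOn (fun φ => arcsin (sin φ / x)) (Set.Ioo 0 (π / 2)) := by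
    intro a ha b hb hab
    have ha' := hquot a ha
    have hb' := hquot b hb
    have h := injOn_arcsin ⟨by linarith, by linarith⟩ ⟨by linarith, by linarith⟩ hab
    have h' : sin a = sin b := by field_simp at h; exact h
    exact injOn_sin ⟨by linarith [ha.1], ha.2.le⟩ ⟨by linarith [hb.1], hb.2.le⟩ h'
  rw [hrestrict, ← himage,
    integral_image_eq_integral_abs_deriv_smul measurableSet_Ioo hderiv hinj, K,
    ← integral_const_mul]
  refine setIntegral_congr_fun measurableSet_Ioo fun φ hφ => ?_
  obtain ⟨h0, h1⟩ := hquot φ hφ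
  obtain ⟨-, -, hc⟩ := hmem φ hφ
  have hr : 0 < √(1 - (sin φ / x) ^ 2) := sqrt_pos.2 (by nlinarith)
  have hsqrt : √(1 - x ^ 2 * (sin φ / x) ^ 2) = cos φ := by
    rw [show 1 - x ^ 2 * (sin φ / x) ^ 2 = cos φ ^ 2 by
      field_simp; linarith [sin_sq_add_cos_sq φ], sqrt_sq hc.le]
  simp only [smul_eq_mul]
  rw [abs_of_pos (by positivity), sin_arcsin (by linarith) h1.le, hsqrt,
    show (1 / x) ^ 2 * sin φ ^ 2 = (sin φ / x) ^ 2 by ring]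
  field_simp

lemma KRe_eq_K (x : ℝ) : KRe x = K x := by
  unfold KRe
  split_ifs with h
  · rfl
  · exact (K_eq_one_div_mul_K_one_div (not_le.1 h)).symm

lemma hasDerivAt_sqrt_div_sqrt {c s x : ℝ} (hs : 0 < 1 - x ^ 2 * s ^ 2) (hcs : 0 < s ^ 2 + c ^ 2) :
    HasDerivAt (fun x => -(c / (s ^ 2 + c ^ 2)) * (√(1 - x ^ 2 * s ^ 2) / √(1 + c ^ 2 * x ^ 2)))
      (1 / √(1 - x ^ 2 * s ^ 2) * (c * x) / (1 + c ^ 2 * x ^ 2) ^ ((3:ℝ)/2)) x := by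
  have hc : 0 < 1 + c ^ 2 * x ^ 2 := by positivity
  have h1 : HasDerivAt (fun x : ℝ => 1 - x ^ 2 * s ^ 2) (-(2 * x * s ^ 2)) x := by
    simpa using (((hasDerivAt_pow 2 x).mul_const (s ^ 2)).const_sub 1)
  have h2 : HasDerivAt (fun x : ℝ => 1 + c ^ 2 * x ^ 2) (c ^ 2 * (2 * x)) x := by
    simpa using (((hasDerivAt_pow 2 x).const_mul (c ^ 2)).const_add 1)
  have hA := sqrt_pos.2 hs
  have hB := sqrt_pos.2 hc
  refine (((h1.sqrt hs.ne').div (h2.sqrt hc.ne') hB.ne').const_mul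
    (-(c / (s ^ 2 + c ^ 2)))).congr_deriv ?_
  rw [rpow_three_halves hc]
  have hA2 := sq_sqrt hs.le
  have hB2 := sq_sqrt hc.le
  set A := √(1 - x ^ 2 * s ^ 2)
  set B := √(1 + c ^ 2 * x ^ 2)
  rw [← hB2]
  field_simp
  rw [hA2, hB2]
  ring

lemma integrableOn_and_integral_kernel {c s : ℝ} (hc : 0 < c) (hs : 0 < s) :
    IntegrableOn (fun x => 1 / √(1 - x ^ 2 * s ^ 2) * (c * x) / (1 + c ^ 2 * x ^ 2) ^ ((3:ℝ)/2))
      (Set.Ioi 0) ∧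
    ∫ x in Set.Ioi (0:ℝ),
      1 / √(1 - x ^ 2 * s ^ 2) * (c * x) / (1 + c ^ 2 * x ^ 2) ^ ((3:ℝ)/2) =
      c / (s ^ 2 + c ^ 2) := by
  have hzero : ∀ x ∈ Set.Ioi (0:ℝ) \ Set.Ioc 0 (1 / s),
      1 / √(1 - x ^ 2 * s ^ 2) * (c * x) / (1 + c ^ 2 * x ^ 2) ^ ((3:ℝ)/2) = 0 := by
    rintro x ⟨hx0, hx⟩
    have hx0 : 0 < x := hx0
    have h : 1 / s < x := by
      by_contra! h
      exact hx ⟨hx0, h⟩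
    rw [div_lt_iff₀ hs] at h
    rw [one_div_sqrt_eq_zero_of_nonpos (by nlinarith), zero_mul, zero_div]
  have hle : 0 ≤ 1 / s := by positivity
  have hcont : ContinuousOn (fun x => -(c / (s ^ 2 + c ^ 2)) *
      (√(1 - x ^ 2 * s ^ 2) / √(1 + c ^ 2 * x ^ 2))) (Set.Icc 0 (1 / s)) := by
    apply Continuous.continuousOn
    have : ∀ x : ℝ, √(1 + c ^ 2 * x ^ 2) ≠ 0 := fun x => (sqrt_pos.2 (by positivity)).ne'
    fun_prop (disch := assumption)
  have hderiv : ∀ x ∈ Set.Ioo 0 (1 / s), HasDerivAt (fun x => -(c / (s ^ 2 + c ^ 2)) *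
      (√(1 - x ^ 2 * s ^ 2) / √(1 + c ^ 2 * x ^ 2)))
      (1 / √(1 - x ^ 2 * s ^ 2) * (c * x) / (1 + c ^ 2 * x ^ 2) ^ ((3:ℝ)/2)) x := by
    rintro x ⟨hx0, hx⟩
    rw [lt_div_iff₀ hs] at hx
    have : 0 < x * s := by positivity
    exact hasDerivAt_sqrt_div_sqrt (by nlinarith) (by positivity)
  have hint := intervalIntegral.integrableOn_deriv_of_nonneg hcont hderiv (by
    rintro x ⟨hx0, -⟩
    positivity)
  refine ⟨hint.of_forall_sdiff_eq_zero measurableSet_Ioi hzero, ?_⟩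
  rw [setIntegral_eq_of_subset_of_forall_sdiff_eq_zero measurableSet_Ioi
      Set.Ioc_subset_Ioi_self hzero, ← intervalIntegral.integral_of_le hle,
    intervalIntegral.integral_eq_sub_of_hasDerivAt_of_le hle hcont hderiv
      ((intervalIntegrable_iff_integrableOn_Ioc_of_le hle).2 hint)]
  simp [hs.ne']

lemma hasDerivAt_add_arctan {k θ : ℝ} (hk : 0 < k) :
    HasDerivAt (fun θ => θ + arctan ((k - 1) * (sin θ * cos θ) / (cos θ ^ 2 + k * sin θ ^ 2)))
      (k / (cos θ ^ 2 + k ^ 2 * sin θ ^ 2)) θ := by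
  have hpos : ∀ a : ℝ, 0 < a → 0 < cos θ ^ 2 + a * sin θ ^ 2 := by
    intro a ha
    by_cases h : cos θ = 0
    · have := sin_sq_add_cos_sq θ
      rw [h] at this ⊢
      nlinarith
    · positivity
  have hD := hpos k hk
  have hE := hpos (k ^ 2) (by positivity)
  have hnum : HasDerivAt (fun θ => (k - 1) * (sin θ * cos θ))
      ((k - 1) * (cos θ * cos θ + sin θ * -sin θ)) θ :=
    ((hasDerivAt_sin θ).mul (hasDerivAt_cos θ)).const_mul _
  have hden : HasDerivAt (fun θ => cos θ ^ 2 + k * sin θ ^ 2)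
      (2 * cos θ * -sin θ + k * (2 * sin θ * cos θ)) θ := by
    exact (((hasDerivAt_cos θ).pow 2).add (((hasDerivAt_sin θ).pow 2).const_mul k)).congr_deriv
      (by simp)
  refine ((hasDerivAt_id θ).add (hnum.div hden hD.ne').arctan).congr_deriv ?_
  have hsq : cos θ ^ 2 = 1 - sin θ ^ 2 := by linarith [sin_sq_add_cos_sq θ]
  have hkey : 1 + ((k - 1) * (sin θ * cos θ) / (cos θ ^ 2 + k * sin θ ^ 2)) ^ 2 =
      (cos θ ^ 2 + k ^ 2 * sin θ ^ 2) / (cos θ ^ 2 + k * sin θ ^ 2) ^ 2 := by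
    field_simp
    rw [hsq]
    ring
  rw [Pi.div_apply, hkey]
  field_simp
  grind

lemma integral_div_sin_sq_add_sq {c : ℝ} (hc : 0 < c) :
    ∫ θ in Set.Ioo 0 (π / 2), c / (sin θ ^ 2 + c ^ 2) = π / (2 * √(1 + c ^ 2)) := by
  have hr : 0 < √(1 + c ^ 2) := sqrt_pos.2 (by positivity)
  have hr2 : √(1 + c ^ 2) ^ 2 = 1 + c ^ 2 := sq_sqrt (by positivity)
  set r := √(1 + c ^ 2)
  have hk : 0 < r / c := by positivity
  have hderiv : ∀ θ ∈ Set.uIcc 0 (π / 2), HasDerivAt (fun θ => 1 / r * (θ + arctan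
      ((r / c - 1) * (sin θ * cos θ) / (cos θ ^ 2 + r / c * sin θ ^ 2))))
      (c / (sin θ ^ 2 + c ^ 2)) θ := by
    intro θ _
    refine ((hasDerivAt_add_arctan (θ := θ) hk).const_mul (1 / r)).congr_deriv ?_
    have : cos θ ^ 2 + (r / c) ^ 2 * sin θ ^ 2 = (sin θ ^ 2 + c ^ 2) / c ^ 2 := by
      rw [div_pow, hr2, cos_sq']
      field_simp
      ring
    rw [this]
    field_simp
  have hcont : Continuous fun θ => c / (sin θ ^ 2 + c ^ 2) := by
    have : ∀ θ, sin θ ^ 2 + c ^ 2 ≠ 0 := fun θ => by positivity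
    fun_prop (disch := assumption)
  rw [← integral_Ioc_eq_integral_Ioo, ← intervalIntegral.integral_of_le (by positivity),
    intervalIntegral.integral_eq_sub_of_hasDerivAt hderiv (hcont.intervalIntegrable _ _)]
  simp
  field_simp

theorem stmt19 (c : ℝ) (hc : 0 < c) :
    ∫ x in Set.Ioi (0:ℝ), KRe x * (c * x) / (1 + c ^ 2 * x ^ 2) ^ ((3:ℝ)/2) =
      Real.pi / (2 * Real.sqrt (1 + c ^ 2)) := by
  have hsin : ∀ θ ∈ Set.Ioo 0 (π / 2), 0 < sin θ := fun θ hθ =>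
    sin_pos_of_pos_of_lt_pi hθ.1 (by linarith [hθ.2, pi_pos])
  set f : ℝ → ℝ → ℝ := fun x θ =>
    1 / √(1 - x ^ 2 * sin θ ^ 2) * (c * x) / (1 + c ^ 2 * x ^ 2) ^ ((3:ℝ)/2) with hf
  have hmeas : Measurable (Function.uncurry f) := by
    unfold Function.uncurry
    fun_prop
  have hint : Integrable (Function.uncurry f)
      ((volume.restrict (Set.Ioi 0)).prod (volume.restrict (Set.Ioo 0 (π / 2)))) := by
    rw [integrable_prod_iff' hmeas.aestronglyMeasurable]
    constructor
    · filter_upwards [ae_restrict_mem measurableSet_Ioo] with θ hθ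
      exact (integrableOn_and_integral_kernel hc (hsin θ hθ)).1
    · have hcont : Continuous fun θ => c / (sin θ ^ 2 + c ^ 2) := by
        have : ∀ θ, sin θ ^ 2 + c ^ 2 ≠ 0 := fun θ => by positivity
        fun_prop (disch := assumption)
      have hi : IntegrableOn (fun θ => c / (sin θ ^ 2 + c ^ 2)) (Set.Ioo 0 (π / 2)) :=
        (hcont.integrableOn_Icc (a := 0) (b := π / 2)).mono_set Set.Ioo_subset_Icc_self
      refine hi.congr_fun (fun θ hθ => ?_) measurableSet_Ioo
      simp only
      rw [← (integrableOn_and_integral_kernel hc (hsin θ hθ)).2]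
      refine setIntegral_congr_fun measurableSet_Ioi fun x hx => ?_
      have hx : 0 < x := hx
      simp only [Function.uncurry, hf]
      rw [norm_of_nonneg (by positivity)]
  calc ∫ x in Set.Ioi (0:ℝ), KRe x * (c * x) / (1 + c ^ 2 * x ^ 2) ^ ((3:ℝ)/2)
      = ∫ x in Set.Ioi (0:ℝ), ∫ θ in Set.Ioo 0 (π / 2), f x θ := by
        congr 1
        ext x
        simp only [hf, KRe_eq_K, K]
        rw [integral_div, integral_mul_const]
    _ = ∫ θ in Set.Ioo 0 (π / 2), ∫ x in Set.Ioi (0:ℝ), f x θ := integral_integral_swap hint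
    _ = ∫ θ in Set.Ioo 0 (π / 2), c / (sin θ ^ 2 + c ^ 2) :=
        setIntegral_congr_fun measurableSet_Ioo fun θ hθ =>
          (integrableOn_and_integral_kernel hc (hsin θ hθ)).2
    _ = π / (2 * √(1 + c ^ 2)) := integral_div_sin_sq_add_sq hc
end
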